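/- arXiv:2111.14784 — 4 statements merged into one kernel-verified Lean document; each statement's English description precedes it below -/
import Mathlib

section
/- Let F/E be a finite Galois extension, ψ a place of F unramified over E, ψ* : Gal(Ē) → Gal(F/E) the associated homomorphism, and E' an intermediate field of F/E with residue field Ē'. Then ψ*(Gal(Ē')) = Gal(F/E') ∩ ψ*(Gal(Ē)). -/
open IsLocalRing
noncomputable section
section Pre
variable {E F : Type*} [Field E] [Field F] [Algebra E F]

def comapHom (A : ValuationSubring F) : (A.comap (algebraMap E F)) →+* A where
  toFun x := ⟨algebraMap E F x.1, x.2⟩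
  map_one' := by ext; simp
  map_mul' x y := by ext; simp
  map_zero' := by ext; simp
  map_add' x y := by ext; simp

instance comapHom_local (A : ValuationSubring F) : IsLocalHom (comapHom (E := E) A) := by
  constructor
  intro a ha
  rcases ha with ⟨u, hu⟩
  have h1 : (u.val : F) * (u.inv : F) = 1 := by
    have := congrArg (Subtype.val) u.val_inv
    exact_mod_cast this
  have hval : (u.val : F) = algebraMap E F a.1 := by
    rw [hu]; rfl
  have h0 : (a.1 : E) ≠ 0 := by
    intro h
    rw [hval, h, map_zero, zero_mul] at h1
    exact zero_ne_one h1
  have hinv : (u.inv : F) = algebraMap E F (a.1⁻¹) := by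
    rw [map_inv₀]
    exact eq_inv_of_mul_eq_one_left (by rw [← hval, mul_comm]; exact h1)
  have hmem : (a.1)⁻¹ ∈ A.comap (algebraMap E F) := by
    show algebraMap E F (a.1⁻¹) ∈ A
    rw [← hinv]
    exact (u.inv : A).2
  refine isUnit_iff_exists_inv.mpr ⟨⟨_, hmem⟩, ?_⟩
  ext
  show (a.1 : E) * (a.1)⁻¹ = 1
  exact mul_inv_cancel₀ h0

def residueMap (A : ValuationSubring F) :
    ResidueField (A.comap (algebraMap E F)) →+* ResidueField A :=
  ResidueField.map (comapHom A)

end Pre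

open IsLocalRing

variable (E F : Type*) [Field E] [Field F] [Algebra E F]

/-- The place `ψ` is unramified over `E`: the residue field extension `F̄/Ē` is separable
and the inertia group is trivial (every automorphism of `F/E` preserving the valuation
ring and inducing the identity on the residue field is trivial). -/
def IsUnramifiedPlace (A : ValuationSubring F) : Prop :=
  (letI : Algebra (ResidueField (A.comap (algebraMap E F))) (ResidueField A) :=
      (residueMap A).toAlgebra;
    Algebra.IsSeparable (ResidueField (A.comap (algebraMap E F))) (ResidueField A)) ∧
  ∀ σ : F ≃ₐ[E] F, (∀ x : F, x ∈ A → σ x ∈ A) →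
    (∀ x : A, ∃ h : σ x ∈ A, residue A ⟨σ x, h⟩ = residue A x) → σ = 1

/-- The algebra structure of an algebraic closure of `F̄` over `Ē`, via the residue
embedding `Ē → F̄`. -/
def bigResAlgebra (A : ValuationSubring F) :
    Algebra (ResidueField (A.comap (algebraMap E F))) (AlgebraicClosure (ResidueField A)) :=
  ((algebraMap (ResidueField A) (AlgebraicClosure (ResidueField A))).comp
    (residueMap A)).toAlgebra

/-- The defining property of `ψ* : Gal(Ē) → Gal(F/E)`: for every `x` in the valuation
ring, `overline(ψ*(σ̄)(x)) = σ̄(x̄)` (inside an algebraic closure of `F̄`). -/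
def IsPlaceStarHom (A : ValuationSubring F)
    (ψs : (letI := bigResAlgebra E F A;
        AlgebraicClosure (ResidueField A) ≃ₐ[ResidueField (A.comap (algebraMap E F))]
          AlgebraicClosure (ResidueField A)) → F ≃ₐ[E] F) : Prop :=
  letI := bigResAlgebra E F A;
  ∀ σb, ∀ x : A, ∃ h : (ψs σb) x ∈ A,
    algebraMap (ResidueField A) (AlgebraicClosure (ResidueField A)) (residue A ⟨(ψs σb) x, h⟩)
      = σb (algebraMap (ResidueField A) (AlgebraicClosure (ResidueField A)) (residue A x))


section Helpers

open scoped Pointwise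

/-- If `σ` stabilizes the prime `Q` and acts trivially modulo `Q` on the `H`-invariants, then modulo
`Q` it agrees with some element of `H`. -/
theorem exists_mem_subgroup_smul_sub_smul_mem {B G : Type*} [CommRing B] [Group G]
    [MulSemiringAction G B] (H : Subgroup G) [Finite H] (Q : Ideal B) [Q.IsPrime] (σ : G)
    (hσ : σ • Q = Q) (hfix : ∀ b : B, (∀ τ ∈ H, τ • b = b) → σ • b - b ∈ Q) :
    ∃ τ ∈ H, ∀ b : B, τ • b - σ • b ∈ Q := by
  let R := FixedPoints.subring B H
  let P : Ideal R := Q.under R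
  have : SMulCommClass H R B := ⟨fun h r b ↦ by
    have hr : h • (r : B) = r := r.2 h
    change h • ((r : B) * b) = (r : B) * h • b
    rw [smul_mul', hr]⟩
  have : Algebra.IsInvariant R B H := ⟨fun b hb ↦ ⟨⟨b, hb⟩, rfl⟩⟩
  let e : (B ⧸ Q) ≃+* (B ⧸ Q) :=
    Ideal.quotientEquiv Q Q (MulSemiringAction.toRingEquiv G B σ) hσ.symm
  let f : (B ⧸ Q) ≃ₐ[R ⧸ P] (B ⧸ Q) := AlgEquiv.ofRingEquiv (f := e) (by
    intro r
    obtain ⟨r, rfl⟩ := Ideal.Quotient.mk_surjective r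
    change Ideal.Quotient.mk Q (σ • (r : B)) = Ideal.Quotient.mk Q (r : B)
    exact Ideal.Quotient.eq.mpr (hfix r fun τ hτ ↦ r.2 ⟨τ, hτ⟩))
  obtain ⟨τ, hτ⟩ := Ideal.Quotient.stabilizerHom_surjective H P Q f
  refine ⟨τ.1.1, τ.1.2, fun b ↦ Ideal.Quotient.eq.mp ?_⟩
  exact DFunLike.congr_fun hτ (Ideal.Quotient.mk Q b)

/-- The vanishing of the geometric sum of length `n` forces `n` to be a multiple of a fixed `d ≠ 1`:
the characteristic if `r = 1`, the order of `r` otherwise. -/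
theorem exists_forall_geom_sum_eq_zero_dvd {k : Type*} [Field k] (r : k) :
    ∃ d : ℕ, d ≠ 1 ∧ ∀ n, ∑ i ∈ Finset.range n, r ^ i = 0 → d ∣ n := by
  by_cases hr : r = 1
  · refine ⟨ringChar k, CharP.ringChar_ne_one, fun n hn ↦ ?_⟩
    rw [← ringChar.spec]
    simpa [hr] using hn
  · refine ⟨orderOf r, by simpa [orderOf_eq_one_iff] using hr, fun n hn ↦ ?_⟩
    rw [orderOf_dvd_iff_pow_eq_one, ← sub_eq_zero, ← geom_sum_mul, hn, zero_mul]

theorem exists_forall_not_dvd {ι : Type*} [Finite ι] (d : ι → ℕ) (hd : ∀ i, d i ≠ 1) :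
    ∃ n, 2 ≤ n ∧ ∀ i, ¬ d i ∣ n := by
  classical
  cases nonempty_fintype ι
  let m : ℕ := ∏ i, if d i = 0 then 1 else d i
  have hm : m ≠ 0 := Finset.prod_ne_zero_iff.mpr fun i _ ↦ by split_ifs <;> simp_all
  refine ⟨m + 1, by omega, fun i hi ↦ ?_⟩
  by_cases h : d i = 0
  · rw [h, zero_dvd_iff] at hi
    omega
  · have hdm : d i ∣ m := by
      have := Finset.dvd_prod_of_mem (fun i ↦ if d i = 0 then 1 else d i) (Finset.mem_univ i)
      simpa only [if_neg h] using this
    exact hd i (Nat.dvd_one.mp ((Nat.dvd_add_right hdm).mp hi))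

/-- A valuation ring contains both `1 / (1 + x + ⋯ + x ^ (n - 1))` and `x` times it, provided
`x` lies outside the ring. -/
theorem ValuationSubring.inv_geom_sum_mem {K : Type*} [Field K] (V : ValuationSubring K) {x : K}
    (hx : x ∉ V) {n : ℕ} (hn : 2 ≤ n) :
    (∑ i ∈ Finset.range n, x ^ i)⁻¹ ∈ V ∧ x * (∑ i ∈ Finset.range n, x ^ i)⁻¹ ∈ V := by
  have hx1 : 1 < V.valuation x := by rwa [← not_le, V.valuation_le_one_iff]
  have key : ∀ m, V.valuation (∑ i ∈ Finset.range (m + 1), x ^ i) = V.valuation x ^ m := by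
    intro m
    rw [Finset.sum_range_succ, Valuation.map_add_eq_of_lt_right, map_pow]
    refine V.valuation.map_sum_lt ?_ fun i hi ↦ ?_
    · simpa using pow_ne_zero m (zero_lt_one.trans hx1).ne'
    · simpa only [map_pow] using pow_lt_pow_right₀ hx1 (Finset.mem_range.mp hi)
  obtain ⟨m, rfl⟩ : ∃ m, n = m + 1 + 1 := ⟨n - 2, by omega⟩
  have h0 : 0 < V.valuation x := zero_lt_one.trans hx1
  simp only [← V.valuation_le_one_iff, map_mul, map_inv₀, key]
  refine ⟨inv_le_one_of_one_le₀ (one_le_pow₀ hx1.le), ?_⟩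
  rw [← div_eq_mul_inv, div_le_one₀ (pow_pos h0 _)]
  exact le_self_pow₀ hx1.le (by omega)

/-- Given finitely many valuation rings `V i` and `x`, there is a common denominator `y` of `x` in
`⋂ i, V i` which is a unit in each `V i` containing `x`. -/
theorem exists_common_denominator {K ι : Type*} [Field K] [Finite ι] (V : ι → ValuationSubring K)
    (x : K) :
    ∃ y : K, ∀ i, y ∈ V i ∧ x * y ∈ V i ∧ (x ∈ V i → (V i).valuation y = 1) := by
  have hd : ∀ i, ∃ d : ℕ, d ≠ 1 ∧ ∀ n, ¬ d ∣ n → x ∈ V i →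
      (V i).valuation (∑ j ∈ Finset.range n, x ^ j) = 1 := by
    intro i
    by_cases hx : x ∈ V i
    · obtain ⟨d, hd1, hd⟩ := exists_forall_geom_sum_eq_zero_dvd (residue (V i) ⟨x, hx⟩)
      refine ⟨d, hd1, fun n hn _ ↦ ?_⟩
      have hne := mt (hd n) hn
      have h1 : IsUnit (∑ j ∈ Finset.range n, (⟨x, hx⟩ : V i) ^ j) := by
        rw [← residue_ne_zero_iff_isUnit]
        simpa only [map_sum, map_pow] using hne
      simpa using ((V i).valuation_eq_one_iff _).mp h1
    · exact ⟨0, zero_ne_one, fun n _ h ↦ absurd h hx⟩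
  choose d hd1 hd using hd
  obtain ⟨n, hn, hdn⟩ := exists_forall_not_dvd d hd1
  refine ⟨(∑ j ∈ Finset.range n, x ^ j)⁻¹, fun i ↦ ?_⟩
  by_cases hx : x ∈ V i
  · have h1 := hd i n (hdn i) hx
    have hy : (V i).valuation (∑ j ∈ Finset.range n, x ^ j)⁻¹ = 1 := by rw [map_inv₀, h1, inv_one]
    have hmem := ((V i).valuation_le_one_iff _).mp hy.le
    exact ⟨hmem, (V i).mul_mem _ _ hx hmem, fun _ ↦ hy⟩
  · obtain ⟨h1, h2⟩ := (V i).inv_geom_sum_mem hx hn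
    exact ⟨h1, h2, fun h ↦ absurd h hx⟩

section Conjugates

variable {K G : Type*} [Field K] [Group G] [MulSemiringAction G K] (A : ValuationSubring K)

/-- The intersection of the conjugates of a valuation ring. -/
def conjugatesInf (G : Type*) [Group G] [MulSemiringAction G K] : Subring K where
  carrier := {x | ∀ g : G, g • x ∈ A}
  mul_mem' hx hy g := by
    rw [smul_mul']
    exact A.mul_mem _ _ (hx g) (hy g)
  one_mem' g := by
    rw [smul_one]
    exact A.one_mem
  add_mem' hx hy g := by
    rw [smul_add]
    exact A.add_mem _ _ (hx g) (hy g)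
  zero_mem' g := by
    rw [smul_zero]
    exact A.zero_mem
  neg_mem' hx g := by
    rw [smul_neg]
    exact A.neg_mem _ (hx g)

instance conjugatesInfAction : MulSemiringAction G (conjugatesInf A G) where
  smul g x := ⟨g • (x : K), fun h ↦ by simpa only [mul_smul] using x.2 (h * g)⟩
  one_smul x := Subtype.ext (one_smul G (x : K))
  mul_smul g h x := Subtype.ext (mul_smul g h (x : K))
  smul_zero g := Subtype.ext (smul_zero (A := K) g)
  smul_add g x y := Subtype.ext (smul_add g (x : K) y)
  smul_one g := Subtype.ext (show g • (1 : K) = 1 from smul_one g)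
  smul_mul g x y := Subtype.ext (smul_mul' g (x : K) y)

@[simp]
theorem coe_smul_conjugatesInf (g : G) (x : conjugatesInf A G) :
    ((g • x : conjugatesInf A G) : K) = g • (x : K) := rfl

theorem mem_of_mem_conjugatesInf {x : K} (hx : x ∈ conjugatesInf A G) : x ∈ A := by
  simpa using hx 1

/-- The trace of the maximal ideal of `A` on the intersection of the conjugates of `A`. -/
def conjugatesInfIdeal (G : Type*) [Group G] [MulSemiringAction G K] :
    Ideal (conjugatesInf A G) :=
  (maximalIdeal A).comap
    (Subring.inclusion (T := A.toSubring) fun _ hx ↦ mem_of_mem_conjugatesInf A hx)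

instance : (conjugatesInfIdeal A G).IsPrime :=
  Ideal.IsPrime.comap (K := maximalIdeal A) _

theorem mem_conjugatesInfIdeal {x : conjugatesInf A G} :
    x ∈ conjugatesInfIdeal A G ↔ A.valuation (x : K) < 1 :=
  (A.valuation_lt_one_iff ⟨x, mem_of_mem_conjugatesInf A x.2⟩)

theorem valuation_smul_lt_one {g : G} (hg : ∀ x ∈ A, g⁻¹ • x ∈ A) {x : K}
    (hx : A.valuation x < 1) : A.valuation (g • x) < 1 := by
  by_contra! h
  have h0 : g • x ≠ 0 := fun h0 ↦ by simp [h0] at h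
  have hx0 : x ≠ 0 := fun hx0 ↦ h0 (by rw [hx0, smul_zero])
  have h1 : (g • x)⁻¹ ∈ A := by
    rw [← A.valuation_le_one_iff, map_inv₀]
    exact inv_le_one_of_one_le₀ h
  have h2 := hg _ h1
  rw [smul_inv'', inv_smul_smul, ← A.valuation_le_one_iff, map_inv₀] at h2
  exact h2.not_gt ((one_lt_inv₀ (by simpa [zero_lt_iff] using hx0)).mpr hx)

theorem smul_conjugatesInfIdeal {g : G} (hg : ∀ x ∈ A, g • x ∈ A) (hg' : ∀ x ∈ A, g⁻¹ • x ∈ A) :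
    g • conjugatesInfIdeal A G = conjugatesInfIdeal A G := by
  ext x
  rw [Ideal.mem_pointwise_smul_iff_inv_smul_mem, mem_conjugatesInfIdeal, mem_conjugatesInfIdeal]
  constructor
  · intro h
    simpa using valuation_smul_lt_one A hg' h
  · exact valuation_smul_lt_one A (by simpa using hg)

/-- An automorphism acting trivially on the intersection of the conjugates of `A` modulo the
maximal ideal acts trivially on `A` modulo the maximal ideal. -/
theorem valuation_smul_sub_lt_one [Finite G] {g : G}
    (hg : ∀ b : conjugatesInf A G, g • b - b ∈ conjugatesInfIdeal A G) {x : K} (hx : x ∈ A) :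
    A.valuation (g • x - x) < 1 := by
  obtain ⟨y, hy⟩ := exists_common_denominator (fun h : G ↦ h • A) x
  have hmem : ∀ z : K, (∀ h : G, z ∈ h • A) → z ∈ conjugatesInf A G := fun z hz h ↦ by
    simpa [ValuationSubring.mem_inv_pointwise_smul_iff] using hz h⁻¹
  have hy1 : A.valuation y = 1 := by
    have := (hy 1).2.2
    rw [one_smul] at this
    exact this hx
  have h1 := (mem_conjugatesInfIdeal A).mp (hg ⟨y, hmem y fun h ↦ (hy h).1⟩)
  have h2 := (mem_conjugatesInfIdeal A).mp (hg ⟨x * y, hmem _ fun h ↦ (hy h).2.1⟩)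
  simp only [AddSubgroupClass.coe_sub, coe_smul_conjugatesInf, smul_mul'] at h1 h2
  have hgy : A.valuation (g • y) = 1 := by
    rw [← sub_add_cancel (g • y) y, Valuation.map_add_eq_of_lt_right _ (by rwa [hy1]), hy1]
  have h3 : A.valuation (x * (g • y - y)) < 1 := by
    rw [map_mul]
    exact mul_lt_one_of_nonneg_of_lt_one_right ((A.valuation_le_one_iff x).mpr hx) zero_le h1
  have h4 : (g • x - x) * g • y = (g • x * g • y - x * y) - x * (g • y - y) := by ring
  have h5 := A.valuation.map_sub_lt h2 h3
  rwa [← h4, map_mul, hgy, mul_one] at h5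

end Conjugates

end Helpers

/-- In the setting of the previous statements, for an intermediate field
`E'` of `F/E` with residue field `Ē'` one has `ψ*(Gal(Ē')) = Gal(F/E') ∩ ψ*(Gal(Ē))`
(stated elementwise: `σ` is the image under `ψ*` of some `σ̄` fixing `Ē'` pointwise iff
`σ` fixes `E'` pointwise and lies in the image of `ψ*`). -/
theorem place_decomposition_hom_intermediate [IsGalois E F] [FiniteDimensional E F]
    (A : ValuationSubring F) (hA : IsUnramifiedPlace E F A)
    (E' : IntermediateField E F) :
    letI := bigResAlgebra E F A;
    ∀ ψs : (AlgebraicClosure (ResidueField A)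
          ≃ₐ[ResidueField (A.comap (algebraMap E F))] AlgebraicClosure (ResidueField A))
        →* (F ≃ₐ[E] F),
      IsPlaceStarHom E F A ψs →
      ∀ σ : F ≃ₐ[E] F,
        (∃ σb, ψs σb = σ ∧
          ∀ x : A, (x : F) ∈ E' →
            σb (algebraMap (ResidueField A) (AlgebraicClosure (ResidueField A)) (residue A x))
              = algebraMap (ResidueField A) (AlgebraicClosure (ResidueField A)) (residue A x))
        ↔ (σ ∈ Set.range ψs ∧ ∀ x : F, x ∈ E' → σ x = x) := by
  intro ψs hψ σ
  constructor
  · rintro ⟨σb, rfl, hσb⟩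
    refine ⟨⟨σb, rfl⟩, ?_⟩
    have hpres : ∀ τb, ∀ x ∈ A, ψs τb x ∈ A := fun τb x hx ↦ (hψ τb ⟨x, hx⟩).1
    have hσ : ∀ x ∈ A, ψs σb • x ∈ A := hpres σb
    have hσ' : ∀ x ∈ A, (ψs σb)⁻¹ • x ∈ A := by
      rw [← map_inv]
      exact hpres σb⁻¹
    have hval : ∀ x ∈ A, x ∈ E' → A.valuation (ψs σb x - x) < 1 := by
      intro x hx hxE
      obtain ⟨h, hres⟩ := hψ σb ⟨x, hx⟩
      rw [hσb ⟨x, hx⟩ hxE] at hres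
      have hres := (algebraMap (ResidueField A) (AlgebraicClosure (ResidueField A))).injective hres
      rw [← sub_eq_zero, ← map_sub, residue_eq_zero_iff, A.valuation_lt_one_iff] at hres
      exact hres
    obtain ⟨τ, hτ, hτσ⟩ := exists_mem_subgroup_smul_sub_smul_mem E'.fixingSubgroup
      (conjugatesInfIdeal A (F ≃ₐ[E] F)) (ψs σb) (smul_conjugatesInfIdeal A hσ hσ') fun b hb ↦ by
        refine (mem_conjugatesInfIdeal A).mpr (hval b (mem_of_mem_conjugatesInf A b.2) ?_)
        rw [← IsGalois.fixedField_fixingSubgroup E', IntermediateField.mem_fixedField_iff]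
        exact fun f hf ↦ congrArg Subtype.val (hb f hf)
    have hρ : ∀ x ∈ A, A.valuation (((ψs σb)⁻¹ * τ) x - x) < 1 := fun x hx ↦ by
      refine valuation_smul_sub_lt_one A (g := (ψs σb)⁻¹ * τ) (fun b ↦ ?_) hx
      rw [mem_conjugatesInfIdeal]
      have := valuation_smul_lt_one A (g := (ψs σb)⁻¹) (by simpa using hσ)
        ((mem_conjugatesInfIdeal A).mp (hτσ b))
      simpa [smul_sub, mul_smul] using this
    have hρA : ∀ x ∈ A, ((ψs σb)⁻¹ * τ) x ∈ A := fun x hx ↦ by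
      rw [← sub_add_cancel (((ψs σb)⁻¹ * τ) x) x]
      exact A.add_mem _ _ ((A.valuation_le_one_iff _).mp (hρ x hx).le) hx
    have hone : (ψs σb)⁻¹ * τ = 1 := hA.2 _ hρA fun x ↦ ⟨hρA x x.2, by
      rw [← sub_eq_zero, ← map_sub, residue_eq_zero_iff, A.valuation_lt_one_iff]
      exact hρ x x.2⟩
    rw [inv_mul_eq_one] at hone
    rw [hone]
    exact (IntermediateField.mem_fixingSubgroup_iff E' τ).mp hτ
  · rintro ⟨⟨σb, rfl⟩, hfix⟩
    refine ⟨σb, rfl, fun x hx ↦ ?_⟩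
    obtain ⟨h, hres⟩ := hψ σb x
    rw [← hres]
    congr 2
    exact Subtype.ext (hfix x hx)
end
end

section
/- Let E/K be a regular field extension, F/E a finite Galois extension, M/K a finite Galois extension containing the algebraic closure L of K in F. Then F and EM are linearly disjoint over EL, F·(EM) = FM, and the square of restriction maps Gal(FM/E) → Gal(F/E), Gal(FM/E) → Gal(M/K) ≅ Gal(EM/E), Gal(F/E) → Gal(L/K), Gal(M/K) → Gal(L/K) is cartesian. -/
open IntermediateField

/-- `A` and `B` are linearly disjoint over `C` (all intermediate fields of `Ω/K`):
every `C`-linearly independent family of elements of `A` is `B`-linearly independent. -/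
def LinDisjOver (K Ω : Type*) [Field K] [Field Ω] [Algebra K Ω]
    (A B C : IntermediateField K Ω) : Prop :=
  ∀ (n : ℕ) (v : Fin n → Ω), (∀ i, v i ∈ A) →
    LinearIndependent ↥C v → LinearIndependent ↥B v

/-- `D` is a regular extension of `C` (inside an algebraically closed field `Ω`):
`D` is linearly disjoint over `C` from every algebraic extension of `C` in `Ω`. -/
def RegOver (K Ω : Type*) [Field K] [Field Ω] [Algebra K Ω]
    (C D : IntermediateField K Ω) : Prop :=
  ∀ B : IntermediateField K Ω, C ≤ B → (∀ x ∈ B, IsIntegral ↥C x) →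
    LinDisjOver K Ω D B C

theorem finiteDimensional_of_sup_eq_top {K E : Type*} [Field K] [Field E] [Algebra K E]
    (M A : IntermediateField K E) [FiniteDimensional K M] (h : M ⊔ A = ⊤) :
    FiniteDimensional A E := by
  obtain ⟨S, hS⟩ := (essFiniteType_iff (F := K) (K := M)).mp inferInstance
  have hAS : adjoin A (S : Set E) = ⊤ := by
    rw [← restrictScalars_eq_top_iff (K := K), restrictScalars_adjoin, adjoin_union, adjoin_self,
      hS, sup_comm, h]
  have : FiniteDimensional A (adjoin A (S : Set E)) := by
    refine finiteDimensional_adjoin fun x hx ↦ ?_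
    have hxM : x ∈ M := hS ▸ subset_adjoin K _ hx
    have hint : IsIntegral K x :=
      (Algebra.IsIntegral.isIntegral (R := K) (⟨x, hxM⟩ : M)).map M.val
    exact hint.tower_top
  rw [hAS] at this
  exact Module.Finite.equiv (topEquiv (F := A) (E := E)).toLinearEquiv

/-- Restriction maps `Gal(E/A)` onto the group of automorphisms of `M` that fix `A ⊓ M`. -/
theorem exists_algEquiv_fixing {K E : Type*} [Field K] [Field E] [Algebra K E]
    (M A : IntermediateField K E) [IsGalois K M] [FiniteDimensional K M] (h : M ⊔ A = ⊤)
    (τ : M ≃ₐ[K] M) (hτ : ∀ x : M, (x : E) ∈ A → τ x = x) :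
    ∃ φ : E ≃ₐ[A] E, ∀ x : M, φ x = τ x := by
  have := finiteDimensional_of_sup_eq_top M A h
  have := IsGalois.sup_right M A h
  have hmem : τ ∈ (restrictRestrictAlgEquivMapHom K M A E).range := by
    rw [← fixingSubgroup_fixedField (restrictRestrictAlgEquivMapHom K M A E).range,
      IntermediateField.mem_fixingSubgroup_iff]
    intro x hx
    refine hτ x ?_
    obtain ⟨y, hy⟩ : (x : E) ∈ Set.range (algebraMap A E) := by
      refine mem_bot.mp <| (IsGalois.mem_bot_iff_fixed _).mpr fun φ ↦ ?_
      rw [← restrictRestrictAlgEquivMapHom_apply M A φ x]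
      rw [mem_fixedField_iff] at hx
      exact congr_arg ((↑) : M → E) <| hx (restrictRestrictAlgEquivMapHom K M A E φ) ⟨φ, rfl⟩
    exact hy ▸ y.2
  obtain ⟨φ, rfl⟩ := hmem
  exact ⟨φ, fun x ↦ (restrictRestrictAlgEquivMapHom_apply M A φ x).symm⟩

theorem algHom_sup_ext {K Ω E : Type*} [Field K] [Field Ω] [Field E] [Algebra K Ω]
    [Algebra K E] {A B : IntermediateField K Ω} {f g : ↥(A ⊔ B) →ₐ[K] E}
    (hA : ∀ (x : Ω) (hx : x ∈ A),
      f ⟨x, (le_sup_left : A ≤ A ⊔ B) hx⟩ = g ⟨x, le_sup_left (b := B) hx⟩)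
    (hB : ∀ (x : Ω) (hx : x ∈ B),
      f ⟨x, (le_sup_right : B ≤ A ⊔ B) hx⟩ = g ⟨x, le_sup_right (a := A) hx⟩) :
    f = g :=
  algHom_ext_of_eq_adjoin (s := (A : Set Ω) ∪ B) K
    (by rw [adjoin_union, adjoin_self, adjoin_self]) fun x hx ↦ hx.elim (hA x) (hB x)

/-- Automorphisms of `A` and of `M` that agree on `A ⊓ M` have a common extension. -/
theorem exists_common_extension {K E : Type*} [Field K] [Field E] [Algebra K E]
    (M A : IntermediateField K E) [IsGalois K M] [FiniteDimensional K M] (h : M ⊔ A = ⊤)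
    (σ₁ : A ≃ₐ[K] A) (σ₂ : M ≃ₐ[K] M)
    (hσ : ∀ (x : E) (hA : x ∈ A) (hM : x ∈ M), (σ₁ ⟨x, hA⟩ : E) = σ₂ ⟨x, hM⟩) :
    ∃ σ : E ≃ₐ[K] E, (∀ x : A, σ x = σ₁ x) ∧ ∀ x : M, σ x = σ₂ x := by
  have hadj : adjoin A (M : Set E) = ⊤ := by
    rw [← restrictScalars_eq_top_iff (K := K), restrictScalars_adjoin, adjoin_union, adjoin_self,
      adjoin_self, sup_comm, h]
  obtain ⟨φ, hφ⟩ := exists_algHom_of_adjoin_splits' (S := (M : Set E)) (A.val.comp σ₁.toAlgHom)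
    (fun s hs ↦ by
      have hint : IsIntegral K s :=
        (Algebra.IsIntegral.isIntegral (R := K) (⟨s, hs⟩ : M)).map M.val
      refine ⟨hint.tower_top, hint.minpoly_splits_tower_top' ?_⟩
      have hcomp : (A.val.comp σ₁.toAlgHom).toRingHom.comp (algebraMap K A) = algebraMap K E :=
        (A.val.comp σ₁.toAlgHom).comp_algebraMap
      have hsp := (Normal.splits (F := K) (K := M) inferInstance ⟨s, hs⟩).map (algebraMap M E)
      rw [Polynomial.map_map, ← IsScalarTower.algebraMap_eq, minpoly_eq] at hsp
      rwa [hcomp]) hadj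
  have hφA (x : A) : φ x = σ₁ x := congr($hφ x)
  let τ : M ≃ₐ[K] M := φ.restrictNormal' M
  have hφM (x : M) : φ x = τ x := (φ.restrictNormal_commutes M x).symm
  have hsurj : Function.Surjective φ := by
    have : M ⊔ A ≤ φ.fieldRange := sup_le
      (fun x hx ↦ ⟨τ.symm ⟨x, hx⟩, by simpa using hφM (τ.symm ⟨x, hx⟩)⟩)
      (fun x hx ↦ ⟨σ₁.symm ⟨x, hx⟩, by simpa using hφA (σ₁.symm ⟨x, hx⟩)⟩)
    exact fun x ↦ this (h ▸ mem_top)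
  obtain ⟨ρ, hρ⟩ := exists_algEquiv_fixing M A h (σ₂.trans τ.symm) fun x hx ↦ by
    rw [AlgEquiv.trans_apply, AlgEquiv.symm_apply_eq]
    exact Subtype.ext <| by rw [← hφM, ← hσ x hx x.2, ← hφA]
  refine ⟨(ρ.restrictScalars K).trans (AlgEquiv.ofBijective φ ⟨φ.injective, hsurj⟩),
    fun x ↦ ?_, fun x ↦ ?_⟩
  · exact (congr_arg φ (ρ.commutes x)).trans (hφA x)
  · refine (congr_arg φ (hρ x)).trans ((hφM _).trans ?_)
    rw [AlgEquiv.trans_apply, AlgEquiv.apply_symm_apply]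

theorem restrict_sup_restrict_eq_top {K Ω : Type*} [Field K] [Field Ω] [Algebra K Ω]
    {A B C : IntermediateField K Ω} (hA : A ≤ C) (hB : B ≤ C) (h : A ⊔ B = C) :
    restrict hA ⊔ restrict hB = ⊤ := by
  rw [← lift_inj, lift_top, lift_sup, lift_restrict, lift_restrict, h]

theorem exists_common_extension_sup {K Ω : Type*} [Field K] [Field Ω] [Algebra K Ω]
    (F M : IntermediateField K Ω) [IsGalois K M] [FiniteDimensional K M]
    (σ₁ : F ≃ₐ[K] F) (σ₂ : M ≃ₐ[K] M)
    (hσ : ∀ (x : Ω) (hF : x ∈ F) (hM : x ∈ M), (σ₁ ⟨x, hF⟩ : Ω) = σ₂ ⟨x, hM⟩) :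
    ∃ σ : ↥(F ⊔ M) ≃ₐ[K] ↥(F ⊔ M),
      (∀ (x : Ω) (hx : x ∈ F),
        ((σ ⟨x, (le_sup_left : F ≤ F ⊔ M) hx⟩ : ↥(F ⊔ M)) : Ω) = σ₁ ⟨x, hx⟩) ∧
      ∀ (x : Ω) (hx : x ∈ M),
        ((σ ⟨x, (le_sup_right : M ≤ F ⊔ M) hx⟩ : ↥(F ⊔ M)) : Ω) = σ₂ ⟨x, hx⟩ := by
  let e₁ := restrictAlgEquiv (le_sup_left : F ≤ F ⊔ M)
  let e₂ := restrictAlgEquiv (le_sup_right : M ≤ F ⊔ M)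
  have : IsGalois K (restrict (le_sup_right : M ≤ F ⊔ M)) := IsGalois.of_algEquiv e₂
  have : FiniteDimensional K (restrict (le_sup_right : M ≤ F ⊔ M)) :=
    Module.Finite.equiv e₂.toLinearEquiv
  have he₁ (x : Ω) (hx) (hx') : e₁.symm ⟨⟨x, hx⟩, hx'⟩ = ⟨x, (mem_restrict _ _).1 hx'⟩ :=
    e₁.symm_apply_eq.2 rfl
  have he₂ (x : Ω) (hx) (hx') : e₂.symm ⟨⟨x, hx⟩, hx'⟩ = ⟨x, (mem_restrict _ _).1 hx'⟩ :=
    e₂.symm_apply_eq.2 rfl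
  obtain ⟨σ, h₁, h₂⟩ := exists_common_extension (restrict (le_sup_right : M ≤ F ⊔ M))
    (restrict (le_sup_left : F ≤ F ⊔ M))
    (restrict_sup_restrict_eq_top _ _ (sup_comm M F))
    ((e₁.symm.trans σ₁).trans e₁) ((e₂.symm.trans σ₂).trans e₂) fun x hF hM ↦ by
      obtain ⟨x, hx⟩ := x
      rw [AlgEquiv.trans_apply, AlgEquiv.trans_apply, AlgEquiv.trans_apply, AlgEquiv.trans_apply,
        he₁, he₂]
      exact Subtype.ext (hσ x _ _)
  refine ⟨σ, fun x hx ↦ ?_, fun x hx ↦ ?_⟩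
  · refine congr_arg Subtype.val (h₁ ⟨⟨x, _⟩, (mem_restrict _ _).2 hx⟩) |>.trans ?_
    rw [AlgEquiv.trans_apply, AlgEquiv.trans_apply, he₁]
    rfl
  · refine congr_arg Subtype.val (h₂ ⟨⟨x, _⟩, (mem_restrict _ _).2 hx⟩) |>.trans ?_
    rw [AlgEquiv.trans_apply, AlgEquiv.trans_apply, he₂]
    rfl

theorem inf_sup_le_sup_of_inf_le {K Ω : Type*} [Field K] [Field Ω] [Algebra K Ω]
    {E F M L : IntermediateField K Ω} (hEF : E ≤ F) (hLM : L ≤ M) (hFM : F ⊓ M ≤ L)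
    [IsGalois K M] [FiniteDimensional K M] : F ⊓ (E ⊔ M) ≤ E ⊔ L := by
  rintro x ⟨hxF, hxN⟩
  let M' : IntermediateField K ↥(E ⊔ M) := restrict (le_sup_right : M ≤ E ⊔ M)
  let A : IntermediateField K ↥(E ⊔ M) := restrict (sup_le_sup_left hLM E)
  have hMA : M' ⊔ A = ⊤ := restrict_sup_restrict_eq_top _ _ <| by
    rw [sup_comm, sup_assoc, sup_eq_right.2 hLM]
  let e : M ≃ₐ[K] M' := restrictAlgEquiv (le_sup_right : M ≤ E ⊔ M)
  have : IsGalois K M' := IsGalois.of_algEquiv e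
  have : FiniteDimensional K M' := Module.Finite.equiv e.toLinearEquiv
  have := finiteDimensional_of_sup_eq_top M' A hMA
  have := IsGalois.sup_right M' A hMA
  suffices (⟨x, hxN⟩ : ↥(E ⊔ M)) ∈ (⊥ : IntermediateField A ↥(E ⊔ M)) by
    obtain ⟨⟨y, hy⟩, rfl : y = _⟩ := mem_bot.1 this
    exact (mem_restrict _ _).1 hy
  refine (IsGalois.mem_bot_iff_fixed _).2 fun φ ↦ ?_
  let τ : M ≃ₐ[K] M :=
    (e.trans (restrictRestrictAlgEquivMapHom K M' A ↥(E ⊔ M) φ)).trans e.symm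
  have hτ (x : Ω) (hx : x ∈ M) : (τ ⟨x, hx⟩ : Ω) = φ ⟨x, le_sup_right (a := E) hx⟩ := by
    have h₁ : e (τ ⟨x, hx⟩) = restrictRestrictAlgEquivMapHom K M' A ↥(E ⊔ M) φ (e ⟨x, hx⟩) :=
      e.apply_symm_apply _
    have h₂ := congr_arg Subtype.val h₁
    rw [restrictRestrictAlgEquivMapHom_apply] at h₂
    exact congr_arg Subtype.val h₂
  have hφ (x : Ω) (hx : x ∈ E ⊔ L) : (φ ⟨x, sup_le_sup_left hLM E hx⟩ : Ω) = x :=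
    congr_arg Subtype.val (φ.commutes ⟨⟨x, _⟩, (mem_restrict _ _).2 hx⟩)
  obtain ⟨ψ, hψF, hψM⟩ := exists_common_extension_sup F M AlgEquiv.refl τ fun x hF hM ↦ by
    rw [hτ, hφ x (le_sup_right (a := E) (hFM ⟨hF, hM⟩))]
    rfl
  have hcomp : ((F ⊔ M).val.comp ψ.toAlgHom).comp (inclusion (sup_le_sup_right hEF M)) =
      (E ⊔ M).val.comp (φ.restrictScalars K).toAlgHom :=
    algHom_sup_ext (fun y hy ↦ (hψF y (hEF hy)).trans (hφ y (le_sup_left (b := L) hy)).symm)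
      fun y hy ↦ (hψM y hy).trans (hτ y hy)
  exact Subtype.ext <| congr($hcomp ⟨x, hxN⟩).symm.trans (hψF x hxF)

theorem finiteDimensional_extendScalars_of_sup_eq {K Ω : Type*} [Field K] [Field Ω] [Algebra K Ω]
    {M C N : IntermediateField K Ω} [FiniteDimensional K M] (hMN : M ≤ N) (hCN : C ≤ N)
    (h : M ⊔ C = N) : FiniteDimensional C (extendScalars hCN) := by
  have : FiniteDimensional K (restrict hMN) :=
    Module.Finite.equiv (restrictAlgEquiv hMN).toLinearEquiv
  have := finiteDimensional_of_sup_eq_top (restrict hMN) (restrict hCN) <|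
    restrict_sup_restrict_eq_top hMN hCN h
  exact Module.Finite.of_equiv_equiv (B₂ := extendScalars hCN)
    (restrictAlgEquiv hCN).toRingEquiv.symm
    (RingEquiv.refl N) <| RingHom.ext fun x ↦ by
      obtain ⟨y, rfl⟩ := (restrictAlgEquiv hCN).surjective x
      exact congr_arg (inclusion hCN) ((restrictAlgEquiv hCN).symm_apply_apply y)

theorem isGalois_finiteDimensional_extendScalars_of_le {K Ω : Type*} [Field K] [Field Ω]
    [Algebra K Ω] {E C F : IntermediateField K Ω} (hEF : E ≤ F) (hEC : E ≤ C) (hCF : C ≤ F)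
    [IsGalois E (extendScalars hEF)] [FiniteDimensional E (extendScalars hEF)] :
    IsGalois C (extendScalars hCF) ∧ FiniteDimensional C (extendScalars hCF) := by
  let : Algebra E C := (inclusion hEC).toAlgebra
  let : Algebra C (extendScalars hEF) := (inclusion hCF).toAlgebra
  have : IsScalarTower E C (extendScalars hEF) := .of_algebraMap_eq fun _ ↦ rfl
  have hG : IsGalois C (extendScalars hEF) := IsGalois.tower_top_of_isGalois E _ _
  have hfin : FiniteDimensional C (extendScalars hEF) := Module.Finite.right E _ _
  let e : extendScalars hEF ≃ₐ[C] extendScalars hCF :=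
    AlgEquiv.ofRingEquiv (f := RingEquiv.refl F) fun _ ↦ rfl
  exact ⟨IsGalois.of_algEquiv e, Module.Finite.equiv e.toLinearEquiv⟩

theorem linDisjOver_of_inf_le {K Ω : Type*} [Field K] [Field Ω] [Algebra K Ω]
    {A B C : IntermediateField K Ω} (hCA : C ≤ A) (hCB : C ≤ B) (h : A ⊓ B ≤ C)
    [IsGalois C (extendScalars hCA)] [FiniteDimensional C (extendScalars hCA)]
    [FiniteDimensional C (extendScalars hCB)] : LinDisjOver K Ω A B C := by
  intro n v hv hlin
  have hAB : (extendScalars hCA).LinearDisjoint (extendScalars hCB) :=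
    LinearDisjoint.of_inf_eq_bot <| le_bot_iff.1 fun x hx ↦ by
      rw [mem_inf, mem_extendScalars, mem_extendScalars] at hx
      exact mem_bot.2 ⟨⟨x, h (mem_inf.2 hx)⟩, rfl⟩
  have hvA : LinearIndependent C fun i ↦ (⟨v i, hv i⟩ : extendScalars hCA) :=
    LinearIndependent.of_comp (extendScalars hCA).val.toLinearMap hlin
  exact hAB.linearIndependent_left hvA

theorem apply_mem_of_normal {K Ω : Type*} [Field K] [Field Ω] [Algebra K Ω]
    {E F N : IntermediateField K Ω} (hEF : E ≤ F) (hFN : F ≤ N) [Normal E (extendScalars hEF)]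
    (f : N →ₐ[K] N) (hf : ∀ (x : Ω) (hx : x ∈ E), (f ⟨x, hFN (hEF hx)⟩ : Ω) = x)
    (x : Ω) (hx : x ∈ F) : (f ⟨x, hFN hx⟩ : Ω) ∈ F := by
  let g : extendScalars hEF →ₐ[E] Ω :=
    { (N.val.comp f).comp (inclusion hFN) with commutes' := fun r ↦ hf r r.2 }
  have hg : g ⟨x, hx⟩ ∈ g.fieldRange := ⟨_, rfl⟩
  rwa [AlgHom.fieldRange_of_normal] at hg

/-- Let `E/K` be a regular extension, `F/E` a finite Galois extension,
`M/K` a finite Galois extension containing the algebraic closure `L` of `K` in `F`.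
Then `F` and `EM` are linearly disjoint over `EL`, `F·(EM) = FM`, and the square of
restriction maps `Gal(FM/E) → Gal(F/E)`, `Gal(FM/E) → Gal(M/K) ≅ Gal(EM/E)`,
`Gal(F/E) → Gal(L/K)`, `Gal(M/K) → Gal(L/K)` is cartesian (stated elementwise:
every `σ ∈ Gal(FM/E)` stabilizes `F` and `M`, and every pair
`(σ₁, σ₂) ∈ Gal(F/E) × Gal(M/K)` agreeing on `L` has a unique common extension). -/
theorem field_crossing_cartesian (K Ω : Type*) [Field K] [Field Ω] [Algebra K Ω]
    [IsAlgClosed Ω]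
    (E F M L : IntermediateField K Ω)
    (hEF : E ≤ F) (hLF : L ≤ F) (hLM : L ≤ M)
    (hreg : RegOver K Ω ⊥ E)
    (hL : ∀ x : Ω, x ∈ L ↔ x ∈ F ∧ IsIntegral K x)
    [IsGalois ↥E ↥(extendScalars hEF)] [FiniteDimensional ↥E ↥(extendScalars hEF)]
    [IsGalois K ↥M] [FiniteDimensional K ↥M] :
    LinDisjOver K Ω F (E ⊔ M) (E ⊔ L) ∧
    F ⊔ (E ⊔ M) = F ⊔ M ∧
    (∀ σ : ↥(F ⊔ M) ≃ₐ[K] ↥(F ⊔ M),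
      (∀ (x : Ω) (hx : x ∈ E),
        ((σ ⟨x, (le_sup_left : F ≤ F ⊔ M) (hEF hx)⟩ : ↥(F ⊔ M)) : Ω) = x) →
      (∀ (x : Ω) (hx : x ∈ F),
        ((σ ⟨x, (le_sup_left : F ≤ F ⊔ M) hx⟩ : ↥(F ⊔ M)) : Ω) ∈ F) ∧
      (∀ (x : Ω) (hx : x ∈ M),
        ((σ ⟨x, (le_sup_right : M ≤ F ⊔ M) hx⟩ : ↥(F ⊔ M)) : Ω) ∈ M)) ∧
    (∀ (σ₁ : ↥F ≃ₐ[K] ↥F) (σ₂ : ↥M ≃ₐ[K] ↥M),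
      (∀ (x : Ω) (hx : x ∈ E), ((σ₁ ⟨x, hEF hx⟩ : ↥F) : Ω) = x) →
      (∀ (x : Ω) (hx : x ∈ L),
        ((σ₁ ⟨x, hLF hx⟩ : ↥F) : Ω) = ((σ₂ ⟨x, hLM hx⟩ : ↥M) : Ω)) →
      ∃! σ : ↥(F ⊔ M) ≃ₐ[K] ↥(F ⊔ M),
        (∀ (x : Ω) (hx : x ∈ F),
          ((σ ⟨x, (le_sup_left : F ≤ F ⊔ M) hx⟩ : ↥(F ⊔ M)) : Ω) = ((σ₁ ⟨x, hx⟩ : ↥F) : Ω)) ∧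
        (∀ (x : Ω) (hx : x ∈ M),
          ((σ ⟨x, (le_sup_right : M ≤ F ⊔ M) hx⟩ : ↥(F ⊔ M)) : Ω) = ((σ₂ ⟨x, hx⟩ : ↥M) : Ω))) := by
  have hFM : F ⊓ M ≤ L := fun x hx ↦ (hL x).2
    ⟨hx.1, (Algebra.IsIntegral.isIntegral (R := K) (⟨x, hx.2⟩ : M)).map M.val⟩
  obtain ⟨_, _⟩ :=
    isGalois_finiteDimensional_extendScalars_of_le hEF le_sup_left (sup_le hEF hLF)
  have : FiniteDimensional ↥(E ⊔ L) (extendScalars (sup_le_sup_left hLM E)) :=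
    finiteDimensional_extendScalars_of_sup_eq (M := M) le_sup_right (sup_le_sup_left hLM E) <| by
      rw [sup_comm, sup_assoc, sup_eq_right.2 hLM]
  refine ⟨linDisjOver_of_inf_le (sup_le hEF hLF) (sup_le_sup_left hLM E)
      (inf_sup_le_sup_of_inf_le hEF hLM hFM), by rw [← sup_assoc, sup_eq_left.2 hEF],
    fun σ hσ ↦ ⟨apply_mem_of_normal hEF le_sup_left σ.toAlgHom hσ, fun x hx ↦ ?_⟩,
    fun σ₁ σ₂ _ hσ ↦ ?_⟩
  · have h := AlgHom.fieldRange_of_normal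
      (((F ⊔ M).val.comp σ.toAlgHom).comp (inclusion (le_sup_right : M ≤ F ⊔ M)))
    exact h.le ⟨⟨x, hx⟩, rfl⟩
  · obtain ⟨σ, h₁, h₂⟩ := exists_common_extension_sup F M σ₁ σ₂ fun x hF hM ↦ hσ x (hFM ⟨hF, hM⟩)
    refine ⟨σ, ⟨h₁, h₂⟩, fun σ' h ↦ AlgEquiv.ext fun x ↦ ?_⟩
    have heq : σ'.toAlgHom = σ.toAlgHom := algHom_sup_ext
      (fun x hx ↦ Subtype.ext ((h.1 x hx).trans (h₁ x hx).symm))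
      fun x hx ↦ Subtype.ext ((h.2 x hx).trans (h₂ x hx).symm)
    exact congr($heq x)
end

section
/- Let E/K be a regular extension, F/E a finite Galois extension, M/K a finite Galois extension containing the algebraic closure L of K in F, and γ : Gal(K) → Gal(F/E) a homomorphism with res_{F/L} ∘ γ = res_{K_s/L} and Gal(M) ≤ ker(γ). Then there is a unique homomorphism γ' : Gal(K) → Gal(FM/E) with res_{FM/F} ∘ γ' = γ and res_{FM/M} ∘ γ' = res_{K_s/M}. Moreover, if D is the fixed field of γ'(Gal(K)) in FM, then D is a regular extension of K, E ⊆ D ⊆ FM, DM = FM, and γ(Gal(K)) = Gal(F/F ∩ D). -/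
open IntermediateField

section LinearDisjointness

variable {K Ω : Type*} [Field K] [Field Ω] [Algebra K Ω]

theorem LinDisjOver.linearDisjoint {A B : IntermediateField K Ω}
    (h : LinDisjOver K Ω A B ⊥) : A.LinearDisjoint B := by
  let b := Module.Basis.ofVectorSpace K A
  refine .of_basis_left b (linearIndependent_iff_finset_linearIndependent.2 fun s ↦ ?_)
  have hK : LinearIndependent K (A.val ∘ b) :=
    b.linearIndependent.map' A.val.toLinearMap (LinearMap.ker_eq_bot_of_injective A.val.injective)
  let e := s.equivFin
  have hs : LinearIndependent K (fun i ↦ A.val (b (e.symm i))) :=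
    hK.comp (fun i ↦ (e.symm i : _)) (Subtype.val_injective.comp e.symm.injective)
  have hbot : LinearIndependent (⊥ : IntermediateField K Ω) (fun i ↦ A.val (b (e.symm i))) :=
    hs.map_of_surjective_injective (algebraMap K (⊥ : IntermediateField K Ω)) (AddMonoidHom.id Ω)
      (botEquiv K Ω).symm.surjective (by simp) (fun r m ↦ by simp)
  have := h _ _ (fun i ↦ (b (e.symm i)).2) hbot
  rwa [← linearIndependent_equiv e.symm]

theorem IntermediateField.LinearDisjoint.linDisjOver {A B : IntermediateField K Ω}
    (h : A.LinearDisjoint B) : LinDisjOver K Ω A B ⊥ := by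
  intro n v hv hbot
  have hK : LinearIndependent K v :=
    hbot.restrict_scalars fun a b hab ↦
      (algebraMap K (⊥ : IntermediateField K Ω)).injective (by simpa [Algebra.smul_def] using hab)
  have hA : LinearIndependent K (fun i ↦ (⟨v i, hv i⟩ : A)) := hK.of_comp A.val.toLinearMap
  exact h.linearIndependent_left hA

/-- Linear independence passes from `B` to `A` when every element of `A` has a `q`-power in `B`,
provided all `q`-powers of the family are still linearly independent over `B`. -/
theorem LinearIndependent.of_forall_pow_mem (q : ℕ) [ExpChar Ω q] {A B : IntermediateField K Ω}
    (hAB : ∀ x ∈ A, ∃ n : ℕ, x ^ q ^ n ∈ B) {ι : Type*} {v : ι → Ω}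
    (h : ∀ n : ℕ, LinearIndependent B (fun i ↦ v i ^ q ^ n)) : LinearIndependent A v := by
  refine linearIndependent_iff'.2 fun s g hg i hi ↦ ?_
  choose f hf using fun i ↦ hAB (g i) (g i).2
  let n := s.sup f
  have hn (j : ι) (hj : j ∈ s) : (g j : Ω) ^ q ^ n ∈ B := by
    convert! pow_mem (hf j) (q ^ (n - f j)) using 1
    rw [← pow_mul, ← pow_add, Nat.add_sub_of_le (Finset.le_sup hj)]
  have hq := (expChar_pow_pos Ω q n).ne'
  have hsum : ∑ j ∈ s.attach, (⟨(g j : Ω) ^ q ^ n, hn j j.2⟩ : B) • v j ^ q ^ n = 0 := by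
    replace hg := congrArg (fun z : Ω ↦ z ^ q ^ n) hg
    beta_reduce at hg
    rw [sum_pow_char_pow, zero_pow hq, ← Finset.sum_attach] at hg
    rw [← hg]
    refine Finset.sum_congr rfl fun j _ ↦ ?_
    simp only [Algebra.smul_def, mul_pow]
    rfl
  have := linearIndependent_iff'.1 ((h n).comp (Subtype.val : s → ι) Subtype.val_injective)
    s.attach _ hsum ⟨i, hi⟩ (Finset.mem_attach _ _)
  exact Subtype.ext (eq_zero_of_pow_eq_zero (congrArg Subtype.val this))

theorem exists_pow_mem_separableClosure_of_isAlgebraic {A : Type*} [Field A] [Algebra K A]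
    [Algebra.IsAlgebraic K A] (q : ℕ) [ExpChar K q] (y : A) :
    ∃ n : ℕ, y ^ q ^ n ∈ separableClosure K A := by
  have : ExpChar (separableClosure K A) q :=
    expChar_of_injective_algebraMap (algebraMap K (separableClosure K A)).injective q
  obtain ⟨n, z, hz⟩ := (isPurelyInseparable_iff_pow_mem (separableClosure K A) q).1
    (separableClosure.isPurelyInseparable K A) y
  exact ⟨n, hz ▸ z.2⟩

theorem exists_pow_mem_separableClosure (q : ℕ) [ExpChar K q] {x : Ω} (hx : IsIntegral K x) :
    ∃ n : ℕ, x ^ q ^ n ∈ separableClosure K Ω := by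
  have := isAlgebraic_adjoin_simple hx
  obtain ⟨n, hn⟩ := exists_pow_mem_separableClosure_of_isAlgebraic (K := K) q
    (AdjoinSimple.gen K x)
  have h := (map_mem_separableClosure_iff (F := K) K⟮x⟯.val).2 hn
  rw [map_pow] at h
  exact ⟨n, h⟩

/-- Linear disjointness from the perfect closure implies that linear independence is preserved
under raising to `q`-powers. -/
theorem IntermediateField.LinearDisjoint.linearIndependent_pow [IsAlgClosed Ω]
    (q : ℕ) [ExpChar K q] {D : IntermediateField K Ω}
    (h : D.LinearDisjoint (perfectClosure K Ω)) {ι : Type*} {v : ι → D}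
    (hv : LinearIndependent K v) (n : ℕ) : LinearIndependent K (fun i ↦ v i ^ q ^ n) := by
  have : ExpChar Ω q := expChar_of_injective_algebraMap (algebraMap K Ω).injective q
  refine linearIndependent_iff'.2 fun s g hg i hi ↦ ?_
  have hq := expChar_pow_pos Ω q n
  choose r hr using fun i ↦ IsAlgClosed.exists_pow_nat_eq (algebraMap K Ω (g i)) hq
  have hrP (i : ι) : r i ∈ perfectClosure K Ω :=
    (mem_perfectClosure_iff_pow_mem q).2 ⟨n, g i, (hr i).symm⟩
  have hsum : ∑ j ∈ s, (⟨r j, hrP j⟩ : perfectClosure K Ω) • (v j : Ω) = 0 := by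
    refine eq_zero_of_pow_eq_zero (n := q ^ n) ?_
    rw [sum_pow_char_pow, ← map_zero D.val, ← hg, map_sum]
    refine Finset.sum_congr rfl fun j _ ↦ ?_
    simp [Algebra.smul_def, mul_pow, ← hr]
  have h0 : r i = 0 :=
    congrArg Subtype.val (linearIndependent_iff'.1 (h.linearIndependent_left hv) s _ hsum i hi)
  exact (algebraMap K Ω).injective (by rw [← hr, h0, zero_pow hq.ne', map_zero])

theorem linearDisjoint_algebraicClosure [IsAlgClosed Ω] {D : IntermediateField K Ω}
    (hsep : D.LinearDisjoint (separableClosure K Ω))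
    (hperf : D.LinearDisjoint (perfectClosure K Ω)) :
    D.LinearDisjoint (algebraicClosure K Ω) := by
  obtain ⟨q, _⟩ := ExpChar.exists K
  have : ExpChar Ω q := expChar_of_injective_algebraMap (algebraMap K Ω).injective q
  let b := Module.Basis.ofVectorSpace K D
  refine .of_basis_left b <| .of_forall_pow_mem q
    (fun x hx ↦ exists_pow_mem_separableClosure q (mem_algebraicClosure_iff.1 hx).isIntegral)
    fun n ↦ ?_
  exact hsep.linearIndependent_left (hperf.linearIndependent_pow q b.linearIndependent n)

theorem exists_minpoly_eq_map {L F : IntermediateField K Ω} (hLF : L ≤ F)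
    (hL : ∀ x ∈ F, IsIntegral K x → x ∈ L) {m : Ω} (hm : IsIntegral K m) :
    ∃ g : Polynomial L, g.map (inclusion hLF).toRingHom = minpoly F m ∧
      g.natDegree = (minpoly F m).natDegree ∧ g.Monic := by
  refine Polynomial.lifts_and_natDegree_eq_and_monic
    ((Polynomial.lifts_iff_coeff_lifts _).2 fun n ↦ ?_) (minpoly.monic hm.tower_top)
  have hint : IsIntegral K ((minpoly F m).coeff n) :=
    Polynomial.isIntegral_coeff_of_dvd _ _ (minpoly.monic hm) (minpoly.monic hm.tower_top)
      (minpoly.dvd_map_of_isScalarTower K F m) n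
  exact ⟨⟨_, hL _ ((minpoly F m).coeff n).2 (hint.map F.val)⟩, rfl⟩

theorem linearDisjoint_adjoin_simple {D : IntermediateField K Ω}
    (hD : ∀ x ∈ D, IsIntegral K x → x ∈ (⊥ : IntermediateField K Ω)) {m : Ω}
    (hm : IsIntegral K m) : D.LinearDisjoint K⟮m⟯ := by
  obtain ⟨g, hg, hdeg, hmon⟩ := exists_minpoly_eq_map bot_le hD hm
  have hle : (minpoly K m).natDegree ≤ (minpoly D m).natDegree := by
    let g' : Polynomial K := g.map (botEquiv K Ω : (⊥ : IntermediateField K Ω) →+* K)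
    have hg' : g'.map (algebraMap K D) = minpoly D m := by
      rw [← hg, Polynomial.map_map]
      congr 1
      ext x
      obtain ⟨y, rfl⟩ := (botEquiv K Ω).symm.surjective x
      simp
    rw [← hg', Polynomial.natDegree_map]
    refine Polynomial.natDegree_le_of_dvd (minpoly.dvd K m ?_) (hmon.map _).ne_zero
    rw [← Polynomial.aeval_map_algebraMap D, hg', minpoly.aeval]
  let b := adjoin.powerBasis hm
  refine .of_basis_right b.basis ?_
  have := (linearIndependent_pow (K := D) m).comp (Fin.castLE hle) (Fin.castLE_injective hle)
  have hb : K⟮m⟯.val ∘ b.basis = fun i : Fin b.dim ↦ m ^ (i : ℕ) := by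
    funext i
    simp [b]
  rw [hb]
  exact this

theorem linearDisjoint_separableClosure {D : IntermediateField K Ω}
    (hD : ∀ x ∈ D, IsIntegral K x → x ∈ (⊥ : IntermediateField K Ω)) :
    D.LinearDisjoint (separableClosure K Ω) := by
  let b := Module.Basis.ofVectorSpace K D
  refine .of_basis_left b <| linearIndependent_iff'.2 fun s g hg i hi ↦ ?_
  let N : IntermediateField K (separableClosure K Ω) := adjoin K (g '' s)
  have : FiniteDimensional K N :=
    have := (s.finite_toSet.image g).to_subtype
    finiteDimensional_adjoin fun x _ ↦ Algebra.IsIntegral.isIntegral x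
  obtain ⟨m, hm⟩ := Field.exists_primitive_element K N
  let m' : Ω := m.1.1
  have hm' : IsIntegral K m' := ((Algebra.IsIntegral.isIntegral (R := K) m).map N.val).map
    (separableClosure K Ω).val
  have hN (x : N) : (x.1.1 : Ω) ∈ K⟮m'⟯ := by
    have hx : x ∈ K⟮m⟯ := hm ▸ mem_top
    have := (mem_map K⟮m⟯ (f := (separableClosure K Ω).val.comp N.val)).2 ⟨x, hx, rfl⟩
    rwa [adjoin_map, Set.image_singleton] at this
  have hgN (j : s) : ((g j : separableClosure K Ω) : Ω) ∈ K⟮m'⟯ :=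
    hN ⟨g j, subset_adjoin K _ ⟨j, j.2, rfl⟩⟩
  have hsum : ∑ j ∈ s.attach, (⟨(g j : Ω), hgN j⟩ : K⟮m'⟯) • (b j : Ω) = 0 := by
    rw [← hg, ← Finset.sum_attach s]
    rfl
  have hli := (linearDisjoint_adjoin_simple hD hm').linearIndependent_left b.linearIndependent
  have := linearIndependent_iff'.1 (hli.comp (Subtype.val : s → _) Subtype.val_injective)
    s.attach _ hsum ⟨i, hi⟩ (Finset.mem_attach _ _)
  exact Subtype.ext (congrArg (fun z : K⟮m'⟯ ↦ (z : Ω)) this)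

theorem perfectClosure_le_restrictScalars (E : IntermediateField K Ω) :
    perfectClosure K Ω ≤ (perfectClosure E Ω).restrictScalars K := by
  intro x hx
  obtain ⟨q, _⟩ := ExpChar.exists K
  have := expChar_of_injective_algebraMap (algebraMap K E).injective q
  obtain ⟨n, y, hy⟩ := (mem_perfectClosure_iff_pow_mem q).1 hx
  exact (mem_perfectClosure_iff_pow_mem q).2 ⟨n, algebraMap K E y, hy⟩

theorem IntermediateField.LinearDisjoint.of_extendScalars {E D A : IntermediateField K Ω}
    (hED : E ≤ D) (hE : E.LinearDisjoint A) {B : IntermediateField E Ω}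
    (hAB : A ≤ B.restrictScalars K) (hD : (extendScalars hED).LinearDisjoint B) :
    D.LinearDisjoint A := by
  let b := Module.Basis.ofVectorSpace K A
  refine .of_basis_right b ?_
  have hb : LinearIndependent E (fun i ↦ (⟨b i, hAB (b i).2⟩ : B)) :=
    (hE.linearIndependent_right b.linearIndependent).of_comp B.val.toLinearMap
  exact (hD.linearIndependent_right hb).map_of_surjective_injective
    (fun x : extendScalars hED ↦ (⟨x, x.2⟩ : D)) (AddMonoidHom.id Ω) (fun x ↦ ⟨⟨x, x.2⟩, rfl⟩)
    (fun _ h ↦ h) fun _ _ ↦ rfl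

theorem linearDisjoint_perfectClosure {E D : IntermediateField K Ω} (hED : E ≤ D)
    (hE : E.LinearDisjoint (perfectClosure K Ω)) (hD : ∀ x ∈ D, IsSeparable E x) :
    D.LinearDisjoint (perfectClosure K Ω) := by
  have : Algebra.IsSeparable E (extendScalars hED) :=
    (le_separableClosure_iff E Ω (extendScalars hED)).1 fun x hx ↦ hD x hx
  exact hE.of_extendScalars hED (perfectClosure_le_restrictScalars E)
    ((extendScalars hED).linearDisjoint_of_isPurelyInseparable_of_isSeparable _)

end LinearDisjointness

section Compositum

variable {K Ω : Type*} [Field K] [Field Ω] [Algebra K Ω]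

theorem eq_top_of_forall_mem_sup {F N : IntermediateField K Ω} {U : IntermediateField K ↥(F ⊔ N)}
    (hF : ∀ x (hx : x ∈ F), (⟨x, le_sup_left (b := N) hx⟩ : ↥(F ⊔ N)) ∈ U)
    (hN : ∀ x (hx : x ∈ N), (⟨x, le_sup_right (a := F) hx⟩ : ↥(F ⊔ N)) ∈ U) : U = ⊤ := by
  have h : F ⊔ N ≤ U.map (F ⊔ N).val :=
    sup_le (fun x hx ↦ ⟨_, hF x hx, rfl⟩) (fun x hx ↦ ⟨_, hN x hx, rfl⟩)
  refine eq_top_iff.2 fun x _ ↦ ?_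
  obtain ⟨y, hy, hyx⟩ := h x.2
  rwa [← Subtype.ext (a1 := y) (a2 := x) hyx]

theorem algHom_ext_of_sup {F N : IntermediateField K Ω} {A : Type*} [Semiring A] [Algebra K A]
    [Nontrivial A] {φ ψ : ↥(F ⊔ N) →ₐ[K] A}
    (hF : ∀ x (hx : x ∈ F), φ ⟨x, le_sup_left (b := N) hx⟩ = ψ ⟨x, le_sup_left (b := N) hx⟩)
    (hN : ∀ x (hx : x ∈ N), φ ⟨x, le_sup_right (a := F) hx⟩ = ψ ⟨x, le_sup_right (a := F) hx⟩) :
    φ = ψ := by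
  let U : IntermediateField K ↥(F ⊔ N) :=
    { AlgHom.equalizer φ ψ with
      inv_mem' := fun x hx ↦ eq_on_inv₀ φ ψ hx }
  have hU : U = ⊤ := eq_top_of_forall_mem_sup hF hN
  exact AlgHom.ext fun x ↦ show x ∈ U from hU ▸ mem_top

/-- If `L` contains all elements of `F` which are algebraic over `K`, then embeddings of `F` and of
a finite separable extension `N` of `K` which agree on `L` extend jointly to `F ⊔ N`. -/
theorem exists_algHom_sup {L F N : IntermediateField K Ω} (hLF : L ≤ F) (hLN : L ≤ N)
    (hL : ∀ x ∈ F, IsIntegral K x → x ∈ L) [FiniteDimensional K N] [Algebra.IsSeparable K N]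
    (f : F →ₐ[K] Ω) (g : N →ₐ[K] Ω)
    (hfg : ∀ x (hx : x ∈ L), f ⟨x, hLF hx⟩ = g ⟨x, hLN hx⟩) :
    ∃ φ : ↥(F ⊔ N) →ₐ[K] Ω,
      (∀ x (hx : x ∈ F), φ ⟨x, le_sup_left (b := N) hx⟩ = f ⟨x, hx⟩) ∧
      ∀ x (hx : x ∈ N), φ ⟨x, le_sup_right (a := F) hx⟩ = g ⟨x, hx⟩ := by
  obtain ⟨m, hm⟩ := Field.exists_primitive_element K N
  have hmN : IsIntegral K (m : Ω) := (Algebra.IsIntegral.isIntegral (R := K) m).map N.val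
  have hmF : IsIntegral F (m : Ω) := hmN.tower_top
  have hroot : (minpoly F (m : Ω)).eval₂ (f : F →+* Ω) (g m) = 0 := by
    obtain ⟨p, hp, -, -⟩ := exists_minpoly_eq_map hLF hL hmN
    have hpm : p.eval₂ (inclusion hLN : L →+* N) m = 0 := by
      apply N.val.injective
      have := minpoly.aeval F (m : Ω)
      rw [← hp, Polynomial.aeval_def, Polynomial.eval₂_map] at this
      rw [map_zero, ← this]
      exact Polynomial.hom_eval₂ _ _ (N.val : N →+* Ω) _
    have hcomp : (f : F →+* Ω).comp (inclusion hLF).toRingHom =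
        (g : N →+* Ω).comp (inclusion hLN : L →+* N) := RingHom.ext fun x ↦ hfg x x.2
    rw [← hp, Polynomial.eval₂_map, hcomp]
    have := Polynomial.hom_eval₂ p (inclusion hLN : L →+* N) (g : N →+* Ω) m
    rw [hpm, map_zero] at this
    exact this.symm
  let e := adjoinRootEquivAdjoin F hmF
  let ψ : F⟮(m : Ω)⟯ →+* Ω := (AdjoinRoot.lift (f : F →+* Ω) (g m) hroot).comp
    (e.symm : F⟮(m : Ω)⟯ →+* AdjoinRoot (minpoly F (m : Ω)))
  have hψF (x : F) : ψ (algebraMap F _ x) = f x := by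
    simp [ψ]
  have hψm : ψ (AdjoinSimple.gen F (m : Ω)) = g m := by
    simp [ψ, e]
  have hNm : N = K⟮(m : Ω)⟯ := by
    have := congrArg (map N.val) hm
    simpa [adjoin_map, ← AlgHom.fieldRange_eq_map] using this.symm
  have hle : F ⊔ N ≤ F⟮(m : Ω)⟯.restrictScalars K := by
    refine sup_le (fun x hx ↦ IntermediateField.algebraMap_mem F⟮(m : Ω)⟯ ⟨x, hx⟩)
      (hNm.le.trans ?_)
    rw [adjoin_simple_le_iff]
    exact mem_adjoin_simple_self F (m : Ω)
  let φ : ↥(F ⊔ N) →ₐ[K] Ω :=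
    { ψ.comp (inclusion hle : ↥(F ⊔ N) →+* F⟮(m : Ω)⟯.restrictScalars K) with
      commutes' := fun r ↦ (hψF (algebraMap K F r)).trans (f.commutes r) }
  refine ⟨φ, fun x hx ↦ hψF ⟨x, hx⟩, fun x hx ↦ ?_⟩
  let U : IntermediateField K N :=
    { AlgHom.equalizer (φ.comp (inclusion le_sup_right)) g with
      inv_mem' := fun x hx ↦ eq_on_inv₀ (φ.comp (inclusion le_sup_right)) g hx }
  have hU : K⟮m⟯ ≤ U := adjoin_simple_le_iff.2 hψm
  exact hU (x := ⟨x, hx⟩) (hm ▸ mem_top)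

end Compositum

section FixedField

variable {K A : Type*} [Field K] [Field A] [Algebra K A]

theorem fixingSubgroup_fixedField_of_finite (H : Subgroup (A ≃ₐ[K] A)) [Finite H] :
    fixingSubgroup (fixedField H) = H := by
  refine le_antisymm (fun σ hσ ↦ ?_) ((le_iff_le _ _).1 le_rfl)
  let σ' : A ≃ₐ[FixedPoints.subfield H A] A :=
    { (σ : A ≃+* A) with commutes' := fun x ↦ hσ ⟨x, x.2⟩ }
  obtain ⟨h, hh⟩ := FixedPoints.toAlgAut_surjective H A σ'
  have : (h : A ≃ₐ[K] A) = σ := AlgEquiv.ext fun x ↦ DFunLike.congr_fun hh x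
  exact this ▸ h.2

/-- An intermediate field above the fixed field of a finite group `H` is everything as soon as no
nontrivial element of `H` fixes it. -/
theorem eq_top_of_fixedField_le (H : Subgroup (A ≃ₐ[K] A)) [Finite H] {U : IntermediateField K A}
    (hU : fixedField H ≤ U) (h : ∀ σ ∈ H, (∀ x ∈ U, σ x = x) → σ = 1) : U = ⊤ := by
  have : FiniteDimensional (fixedField H) A :=
    inferInstanceAs (FiniteDimensional (FixedPoints.subfield H A) A)
  have : IsGalois (fixedField H) A := IsGalois.of_fixed_field A H
  have hbot : fixingSubgroup (extendScalars hU) = ⊥ := by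
    refine eq_bot_iff.2 fun σ hσ ↦ ?_
    have hσH : σ.restrictScalars K ∈ fixingSubgroup (fixedField H) := fun x ↦ σ.commutes x
    rw [fixingSubgroup_fixedField_of_finite] at hσH
    have := h _ hσH fun x hx ↦ hσ ⟨x, hx⟩
    exact Subgroup.mem_bot.2 (AlgEquiv.ext fun x ↦ DFunLike.congr_fun this x)
  have htop := IsGalois.fixedField_fixingSubgroup (extendScalars hU)
  rw [hbot, fixedField_bot] at htop
  refine eq_top_iff.2 fun x _ ↦ ?_
  have hx : x ∈ extendScalars hU := htop ▸ mem_top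
  exact hx

theorem MonoidHom.finite_range_of_ker_le {G H H' : Type*} [Group G] [Group H] [Group H'] [Finite H]
    (b : G →* H) (c : G →* H') (h : ∀ g, b g = 1 → c g = 1) : Finite c.range := by
  refine Finite.of_injective (fun y : c.range ↦ b y.2.choose) fun y z hyz ↦ Subtype.ext ?_
  rw [← y.2.choose_spec, ← z.2.choose_spec, ← inv_mul_eq_one, ← map_inv, ← map_mul]
  exact h _ (by rw [map_mul, map_inv, inv_mul_eq_one]; exact hyz)

end FixedField

section FieldCrossing

variable {K Ω : Type*} [Field K] [Field Ω] [Algebra K Ω]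

theorem exists_restrict_of_le {S M : IntermediateField K Ω} (hMS : M ≤ S) [Normal K M] :
    ∃ b : (S ≃ₐ[K] S) →* (M ≃ₐ[K] M),
      ∀ τ x (hx : x ∈ M), (b τ ⟨x, hx⟩ : Ω) = τ ⟨x, hMS hx⟩ := by
  let _ : Algebra M S := (inclusion hMS).toAlgebra
  have : IsScalarTower K M S := .of_algebraMap_eq fun _ ↦ rfl
  exact ⟨AlgEquiv.restrictNormalHom M, fun τ x hx ↦
    congrArg Subtype.val (τ.restrictNormal_commutes M ⟨x, hx⟩)⟩

theorem exists_monoidHom_sup {G : Type*} [Group G] {F N : IntermediateField K Ω}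
    (a : G →* (F ≃ₐ[K] F)) (b : G →* (N ≃ₐ[K] N))
    (h : ∀ g, ∃ φ : ↥(F ⊔ N) →ₐ[K] Ω,
      (∀ x (hx : x ∈ F), φ ⟨x, le_sup_left (b := N) hx⟩ = a g ⟨x, hx⟩) ∧
      ∀ x (hx : x ∈ N), φ ⟨x, le_sup_right (a := F) hx⟩ = b g ⟨x, hx⟩) :
    ∃ c : G →* (↥(F ⊔ N) ≃ₐ[K] ↥(F ⊔ N)),
      (∀ g x (hx : x ∈ F), (c g ⟨x, le_sup_left (b := N) hx⟩ : Ω) = a g ⟨x, hx⟩) ∧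
      ∀ g x (hx : x ∈ N), (c g ⟨x, le_sup_right (a := F) hx⟩ : Ω) = b g ⟨x, hx⟩ := by
  choose φ hφF hφN using h
  have hmem (g : G) (x : ↥(F ⊔ N)) : φ g x ∈ F ⊔ N := by
    have : (F ⊔ N).comap (φ g) = ⊤ := eq_top_of_forall_mem_sup
      (fun x hx ↦ by
        change φ g _ ∈ F ⊔ N
        rw [hφF g x hx]
        exact le_sup_left (a := F) (a g ⟨x, hx⟩).2)
      (fun x hx ↦ by
        change φ g _ ∈ F ⊔ N
        rw [hφN g x hx]
        exact le_sup_right (a := F) (b g ⟨x, hx⟩).2)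
    have hx : x ∈ (F ⊔ N).comap (φ g) := this ▸ mem_top
    exact hx
  let ψ (g : G) : ↥(F ⊔ N) →ₐ[K] ↥(F ⊔ N) := (φ g).codRestrict (F ⊔ N).toSubalgebra (hmem g)
  have hψF (g : G) (x : F) :
      ψ g (inclusion le_sup_left x) = inclusion le_sup_left (a g x) := Subtype.ext (hφF g x x.2)
  have hψN (g : G) (x : N) :
      ψ g (inclusion le_sup_right x) = inclusion le_sup_right (b g x) := Subtype.ext (hφN g x x.2)
  let Ψ : G →* (↥(F ⊔ N) →ₐ[K] ↥(F ⊔ N)) :=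
    { toFun := ψ
      map_one' := algHom_ext_of_sup
        (fun x hx ↦ (hψF 1 ⟨x, hx⟩).trans (by rw [map_one]; rfl))
        (fun x hx ↦ (hψN 1 ⟨x, hx⟩).trans (by rw [map_one]; rfl))
      map_mul' := fun g g' ↦ algHom_ext_of_sup
        (fun x hx ↦ (hψF (g * g') ⟨x, hx⟩).trans (by
          rw [map_mul, AlgEquiv.mul_apply, ← hψF, ← hψF]; rfl))
        (fun x hx ↦ (hψN (g * g') ⟨x, hx⟩).trans (by
          rw [map_mul, AlgEquiv.mul_apply, ← hψN, ← hψN]; rfl)) }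
  exact ⟨(AlgEquiv.algHomUnitsEquiv K ↥(F ⊔ N)).toMonoidHom.comp Ψ.toHomUnits,
    fun g x hx ↦ hφF g x hx, fun g x hx ↦ hφN g x hx⟩

end FieldCrossing

section Regular

variable {K Ω : Type*} [Field K] [Field Ω] [Algebra K Ω] {D E F M : IntermediateField K Ω}

theorem RegOver.linearDisjoint (hE : RegOver K Ω ⊥ E) :
    E.LinearDisjoint (algebraicClosure K Ω) :=
  (hE _ bot_le fun _ hx ↦
    (mem_algebraicClosure_iff'.1 hx).tower_top).linearDisjoint

theorem IntermediateField.LinearDisjoint.regOver (hD : D.LinearDisjoint (algebraicClosure K Ω)) :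
    RegOver K Ω ⊥ D := by
  intro B _ hB
  refine (hD.of_le_right fun x hx ↦ ?_).linDisjOver
  exact mem_algebraicClosure_iff'.2
    (isIntegral_trans (A := (⊥ : IntermediateField K Ω)) x (hB x hx))

theorem isSeparable_of_mem_sup (hEF : E ≤ F) [Algebra.IsSeparable E (extendScalars hEF)]
    (hM : M ≤ separableClosure K Ω) {x : Ω} (hx : x ∈ F ⊔ M) : IsSeparable E x := by
  have h : F ⊔ M ≤ (separableClosure E Ω).restrictScalars K :=
    sup_le (fun _ hy ↦ le_separableClosure E Ω (extendScalars hEF) hy)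
      (hM.trans (separableClosure.le_restrictScalars K E Ω))
  exact h hx

/-- A field `D` which is separable over a regular extension `E` of `K` is regular as soon as `K` is
separably closed in `D`. -/
theorem RegOver.of_isSeparable [IsAlgClosed Ω] (hE : RegOver K Ω ⊥ E) (hED : E ≤ D)
    (hD : ∀ x ∈ D, IsSeparable E x)
    (hbot : ∀ x ∈ D, x ∈ separableClosure K Ω → x ∈ (⊥ : IntermediateField K Ω)) :
    RegOver K Ω ⊥ D := by
  have hperf : D.LinearDisjoint (perfectClosure K Ω) :=
    linearDisjoint_perfectClosure hED
      (hE.linearDisjoint.of_le_right fun x hx ↦ mem_algebraicClosure_iff'.2 <|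
        (Algebra.IsIntegral.isIntegral (⟨x, hx⟩ : perfectClosure K Ω)).map (perfectClosure K Ω).val)
      hD
  refine (linearDisjoint_algebraicClosure (linearDisjoint_separableClosure fun x hx hxK ↦ ?_)
    hperf).regOver
  obtain ⟨n, hn⟩ := exists_pow_mem_separableClosure (ringExpChar K) hxK
  obtain ⟨y, hy⟩ := mem_bot.1 (hbot _ (pow_mem hx _) hn)
  exact hperf.inf_eq_bot.le ⟨hx, mem_perfectClosure_iff.2 ⟨n, y, hy⟩⟩

end Regular

section FieldCrossing

variable {K Ω : Type*} [Field K] [Field Ω] [Algebra K Ω]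

/-- An embedding of `F ⊔ M` which agrees on `M` with an embedding `τ` of the separable closure
agrees with `τ` on every separable element. -/
theorem algHom_sup_apply_eq_of_mem_separableClosure {L F M : IntermediateField K Ω} (hLF : L ≤ F)
    (hLM : L ≤ M) (hL : ∀ x ∈ F, IsIntegral K x → x ∈ L) (hMs : M ≤ separableClosure K Ω)
    [FiniteDimensional K M] (τ : separableClosure K Ω →ₐ[K] Ω) (φ : ↥(F ⊔ M) →ₐ[K] Ω)
    (hφ : ∀ x (hx : x ∈ M), φ ⟨x, le_sup_right (a := F) hx⟩ = τ ⟨x, hMs hx⟩)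
    {x : Ω} (hx : x ∈ F ⊔ M) (hxs : x ∈ separableClosure K Ω) : φ ⟨x, hx⟩ = τ ⟨x, hxs⟩ := by
  have hxN : x ∈ M ⊔ K⟮x⟯ := le_sup_right (a := M) (mem_adjoin_simple_self K x)
  have hNs : M ⊔ K⟮x⟯ ≤ separableClosure K Ω := sup_le hMs (adjoin_simple_le_iff.2 hxs)
  have : FiniteDimensional K K⟮x⟯ := adjoin.finiteDimensional hxs.isIntegral
  have : Algebra.IsSeparable K ↥(M ⊔ K⟮x⟯) := (le_separableClosure_iff K Ω _).1 hNs
  obtain ⟨Φ, hΦF, hΦN⟩ := exists_algHom_sup hLF (hLM.trans le_sup_left) hL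
    (φ.comp (inclusion le_sup_left)) (τ.comp (inclusion hNs))
    fun y hy ↦ hφ y (hLM hy)
  have hle : F ⊔ M ≤ F ⊔ (M ⊔ K⟮x⟯) := sup_le_sup_left le_sup_left F
  have hΦ : Φ.comp (inclusion hle) = φ := algHom_ext_of_sup (fun y hy ↦ hΦF y hy)
    fun y hy ↦ (hΦN y (le_sup_left (b := K⟮x⟯) hy)).trans (hφ y hy).symm
  rw [← hΦ]
  exact hΦN x hxN

end FieldCrossing

/-- (Field crossing argument.)  Let `E/K` be a regular extension,
`F/E` a finite Galois extension, `M/K` a finite Galois extension containing the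
algebraic closure `L` of `K` in `F`, and `γ : Gal(K) → Gal(F/E)` a homomorphism with
`res_{F/L} ∘ γ = res_{K_s/L}` and `Gal(M) ≤ ker γ`.  Then there is a unique
`γ' : Gal(K) → Gal(FM/E)` with `res_{FM/F} ∘ γ' = γ` and `res_{FM/M} ∘ γ' = res_{K_s/M}`;
moreover for `D` the fixed field of `γ'(Gal(K))` in `FM` one has `E ≤ D ≤ FM`, `D/K` is
regular, `DM = FM` and `γ(Gal(K)) = Gal(F/F ∩ D)`. -/
theorem field_crossing_argument (K Ω : Type*) [Field K] [Field Ω] [Algebra K Ω]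
    [IsAlgClosed Ω]
    (E F M L : IntermediateField K Ω)
    (hEF : E ≤ F) (hLF : L ≤ F) (hLM : L ≤ M)
    (hLs : L ≤ separableClosure K Ω) (hMs : M ≤ separableClosure K Ω)
    (hreg : RegOver K Ω ⊥ E)
    (hL : ∀ x : Ω, x ∈ L ↔ x ∈ F ∧ IsIntegral K x)
    [IsGalois ↥E ↥(extendScalars hEF)] [FiniteDimensional ↥E ↥(extendScalars hEF)]
    [IsGalois K ↥M] [FiniteDimensional K ↥M]
    (γ : (↥(separableClosure K Ω) ≃ₐ[K] ↥(separableClosure K Ω)) →* (↥F ≃ₐ[K] ↥F))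
    (hγE : ∀ τ (x : Ω) (hx : x ∈ E), ((γ τ ⟨x, hEF hx⟩ : ↥F) : Ω) = x)
    (hγres : ∀ τ (x : Ω) (hx : x ∈ L),
      ((γ τ ⟨x, hLF hx⟩ : ↥F) : Ω) = ((τ ⟨x, hLs hx⟩ : ↥(separableClosure K Ω)) : Ω))
    (hγker : ∀ τ, (∀ (x : Ω) (hx : x ∈ M),
      ((τ ⟨x, hMs hx⟩ : ↥(separableClosure K Ω)) : Ω) = x) → γ τ = 1) :
    ∃ γ' : (↥(separableClosure K Ω) ≃ₐ[K] ↥(separableClosure K Ω))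
        →* (↥(F ⊔ M) ≃ₐ[K] ↥(F ⊔ M)),
      (∀ τ (x : Ω) (hx : x ∈ F),
        ((γ' τ ⟨x, (le_sup_left : F ≤ F ⊔ M) hx⟩ : ↥(F ⊔ M)) : Ω)
          = ((γ τ ⟨x, hx⟩ : ↥F) : Ω)) ∧
      (∀ τ (x : Ω) (hx : x ∈ M),
        ((γ' τ ⟨x, (le_sup_right : M ≤ F ⊔ M) hx⟩ : ↥(F ⊔ M)) : Ω)
          = ((τ ⟨x, hMs hx⟩ : ↥(separableClosure K Ω)) : Ω)) ∧
      (∀ γ'' : (↥(separableClosure K Ω) ≃ₐ[K] ↥(separableClosure K Ω))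
          →* (↥(F ⊔ M) ≃ₐ[K] ↥(F ⊔ M)),
        (∀ τ (x : Ω) (hx : x ∈ F),
          ((γ'' τ ⟨x, (le_sup_left : F ≤ F ⊔ M) hx⟩ : ↥(F ⊔ M)) : Ω)
            = ((γ τ ⟨x, hx⟩ : ↥F) : Ω)) →
        (∀ τ (x : Ω) (hx : x ∈ M),
          ((γ'' τ ⟨x, (le_sup_right : M ≤ F ⊔ M) hx⟩ : ↥(F ⊔ M)) : Ω)
            = ((τ ⟨x, hMs hx⟩ : ↥(separableClosure K Ω)) : Ω)) →
        γ'' = γ') ∧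
      (letI D : IntermediateField K Ω := (fixedField γ'.range).map (F ⊔ M).val
       E ≤ D ∧ D ≤ F ⊔ M ∧ RegOver K Ω ⊥ D ∧ D ⊔ M = F ⊔ M ∧
       (∀ σ : ↥F ≃ₐ[K] ↥F, σ ∈ γ.range ↔
         ∀ (x : Ω) (hx : x ∈ F ⊓ D),
           σ ⟨x, (inf_le_left : F ⊓ D ≤ F) hx⟩ = ⟨x, (inf_le_left : F ⊓ D ≤ F) hx⟩)) := by
  have hLi : ∀ x ∈ F, IsIntegral K x → x ∈ L := fun x hx hxK ↦ (hL x).2 ⟨hx, hxK⟩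
  obtain ⟨b, hb⟩ := exists_restrict_of_le hMs
  obtain ⟨γ', hγF, hγb⟩ := exists_monoidHom_sup γ b fun τ ↦
    exists_algHom_sup hLF hLM hLi (F.val.comp (γ τ)) (M.val.comp (b τ)) fun x hx ↦
      (hγres τ x hx).trans (hb τ x (hLM hx)).symm
  have hγM (τ) (x : Ω) (hx : x ∈ M) :
      ((γ' τ ⟨x, (le_sup_right : M ≤ F ⊔ M) hx⟩ : ↥(F ⊔ M)) : Ω)
        = ((τ ⟨x, hMs hx⟩ : ↥(separableClosure K Ω)) : Ω) := (hγb τ x hx).trans (hb τ x hx)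
  have hkerγ (τ) (h : b τ = 1) : γ τ = 1 := hγker τ fun x hx ↦ by
    rw [← hb τ x hx, h, AlgEquiv.one_apply]
  have hkerγ' (τ) (h : b τ = 1) : γ' τ = 1 := by
    refine AlgEquiv.coe_toAlgHom_injective (algHom_ext_of_sup (fun x hx ↦ Subtype.ext ?_)
      fun x hx ↦ Subtype.ext ?_)
    · exact (hγF τ x hx).trans (by rw [hkerγ τ h]; rfl)
    · exact (hγb τ x hx).trans (by rw [h]; rfl)
  have : Finite γ.range := MonoidHom.finite_range_of_ker_le b γ hkerγ
  have : Finite γ'.range := MonoidHom.finite_range_of_ker_le b γ' hkerγ'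
  refine ⟨γ', hγF, hγM, fun γ'' hF hM ↦ MonoidHom.ext fun τ ↦ AlgEquiv.coe_toAlgHom_injective
    (algHom_ext_of_sup (fun x hx ↦ Subtype.ext ((hF τ x hx).trans (hγF τ x hx).symm))
      fun x hx ↦ Subtype.ext ((hM τ x hx).trans (hγM τ x hx).symm)), ?_⟩
  let D : IntermediateField K Ω := (fixedField γ'.range).map (F ⊔ M).val
  have hmemD {x : Ω} (hx : x ∈ F ⊔ M) (h : ∀ τ, γ' τ ⟨x, hx⟩ = ⟨x, hx⟩) : x ∈ D :=
    ⟨⟨x, hx⟩, by rintro ⟨_, τ, rfl⟩; exact h τ, rfl⟩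
  have hDle : D ≤ F ⊔ M := by
    rintro _ ⟨y, -, rfl⟩
    exact y.2
  have hfixD {x : Ω} (hx : x ∈ D) (τ) : γ' τ ⟨x, hDle hx⟩ = ⟨x, hDle hx⟩ := by
    obtain ⟨y, hy, rfl⟩ := hx
    exact hy ⟨γ' τ, τ, rfl⟩
  have hED : E ≤ D := fun x hx ↦ hmemD (le_sup_left (b := M) (hEF hx)) fun τ ↦
    Subtype.ext ((hγF τ x (hEF hx)).trans (hγE τ x hx))
  refine ⟨hED, hDle, hreg.of_isSeparable hED
    (fun x hx ↦ isSeparable_of_mem_sup hEF hMs (hDle hx)) fun x hx hxs ↦ ?_,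
    le_antisymm (sup_le hDle le_sup_right) ?_, fun σ ↦ ⟨?_, fun h ↦ ?_⟩⟩
  · have hfix (τ : separableClosure K Ω ≃ₐ[K] separableClosure K Ω) : τ ⟨x, hxs⟩ = ⟨x, hxs⟩ := by
      refine Subtype.ext ((algHom_sup_apply_eq_of_mem_separableClosure hLF hLM hLi hMs
        ((separableClosure K Ω).val.comp τ) ((F ⊔ M).val.comp (γ' τ)) (hγM τ)
        (hDle hx) hxs).symm.trans ?_)
      exact congrArg Subtype.val (hfixD hx τ)
    obtain ⟨y, hy⟩ := mem_bot.1 ((InfiniteGalois.mem_bot_iff_fixed _).2 hfix)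
    exact mem_bot.2 ⟨y, congrArg Subtype.val hy⟩
  · let U : IntermediateField K ↥(F ⊔ M) := (D ⊔ M).comap (F ⊔ M).val
    have hU : U = ⊤ := by
      refine eq_top_of_fixedField_le γ'.range
        (fun x hx ↦ le_sup_left (b := M) (⟨x, hx, rfl⟩ : (x : Ω) ∈ D)) ?_
      rintro _ ⟨τ, rfl⟩ h
      refine hkerγ' τ (AlgEquiv.ext fun x ↦ Subtype.ext ?_)
      refine (hγb τ x x.2).symm.trans ?_
      exact congrArg Subtype.val
        (h ⟨x, le_sup_right (a := F) x.2⟩ (le_sup_right (a := D) x.2))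
    intro x hx
    have : (⟨x, hx⟩ : ↥(F ⊔ M)) ∈ U := hU ▸ mem_top
    exact this
  · rintro ⟨τ, rfl⟩ x hx
    exact Subtype.ext ((hγF τ x hx.1).symm.trans (congrArg Subtype.val (hfixD hx.2 τ)))
  · rw [← fixingSubgroup_fixedField_of_finite γ.range]
    rintro ⟨x, hx⟩
    refine h x ⟨x.2, hmemD (le_sup_left (b := M) x.2) fun τ ↦ Subtype.ext ?_⟩
    exact (hγF τ x x.2).trans (congrArg Subtype.val (hx ⟨γ τ, τ, rfl⟩))
end

section
/- Let L/K be a finite Galois extension of fields with L not formally real, and let P be an ordering on K. Then the set I_P(L/K) of involutions ε ∈ Gal(L/K) such that P extends to an ordering of the fixed field L(ε) is a single conjugacy class in Gal(L/K) (possibly empty is excluded when P exists and L/K is as above, it is a full conjugacy class). -/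
/-- An ordering of the field `K`, given by its cone `P` of elements `≥ 0`:
closed under addition and multiplication, `P ∪ -P = K`, and `-1 ∉ P`. -/
def IsOrderingCone (K : Type*) [Field K] (P : Set K) : Prop :=
  (∀ x ∈ P, ∀ y ∈ P, x + y ∈ P) ∧ (∀ x ∈ P, ∀ y ∈ P, x * y ∈ P) ∧
  (∀ x : K, x ∈ P ∨ -x ∈ P) ∧ (-1 : K) ∉ P

/-- A field is formally real if it admits an ordering. -/
def IsFormallyRealField (K : Type*) [Field K] : Prop :=
  ∃ P : Set K, IsOrderingCone K P

open IntermediateField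

namespace IsOrderingCone

variable {F : Type*} [Field F] {P : Set F}

theorem mul_self_mem (hP : IsOrderingCone F P) (x : F) : x * x ∈ P := by
  obtain ⟨-, hmul, htot, -⟩ := hP
  rcases htot x with h | h
  · exact hmul x h x h
  · simpa using hmul _ h _ h

theorem one_mem (hP : IsOrderingCone F P) : (1 : F) ∈ P := by
  simpa using hP.mul_self_mem 1

theorem zero_mem (hP : IsOrderingCone F P) : (0 : F) ∈ P := by
  simpa using hP.mul_self_mem 0

theorem eq_zero_of_neg_mem (hP : IsOrderingCone F P) {x : F} (hx : x ∈ P) (hx' : -x ∈ P) :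
    x = 0 := by
  by_contra h0
  refine hP.2.2.2 ?_
  have h := hP.2.1 _ (hP.2.1 _ hx _ hx') _ (hP.mul_self_mem x⁻¹)
  have e : x * -x * (x⁻¹ * x⁻¹) = -1 := by field_simp
  rwa [e] at h

/-- An ordering cone is the set of nonnegative elements of a linear order. -/
theorem exists_linearOrder (hP : IsOrderingCone F P) :
    ∃ _ : LinearOrder F, IsStrictOrderedRing F ∧ ∀ x : F, 0 ≤ x ↔ x ∈ P := by
  classical
  let o : LinearOrder F :=
    { le := fun a b => b - a ∈ P
      le_refl := fun a => by simpa using hP.zero_mem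
      le_trans := fun a b c h₁ h₂ => by simpa using hP.1 _ h₁ _ h₂
      le_antisymm := fun a b h₁ h₂ => by
        have := hP.eq_zero_of_neg_mem h₁ (by simpa using h₂)
        exact (sub_eq_zero.mp this).symm
      le_total := fun a b => by simpa using hP.2.2.1 (b - a)
      toDecidableLE := Classical.decRel _ }
  have hle : ∀ a b : F, a ≤ b ↔ b - a ∈ P := fun _ _ => Iff.rfl
  have h1 : IsOrderedAddMonoid F :=
    { add_le_add_left := fun a b h c => by simpa [hle] using h }
  have h2 : ZeroLEOneClass F := ⟨by simpa [hle] using hP.one_mem⟩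
  have h3 : IsOrderedRing F := .of_mul_nonneg fun x y hx hy => by
    simpa [hle] using hP.2.1 x (by simpa [hle] using hx) y (by simpa [hle] using hy)
  exact ⟨o, IsOrderedRing.toIsStrictOrderedRing F, fun x => by simp [hle]⟩

/-- The image of an ordering cone under a field isomorphism. -/
theorem image_ringEquiv {E : Type*} [Field E] (hP : IsOrderingCone F P) (e : F ≃+* E) :
    IsOrderingCone E (e '' P) := by
  obtain ⟨hadd, hmul, htot, hneg⟩ := hP
  refine ⟨?_, ?_, fun x => ?_, ?_⟩
  · rintro _ ⟨x, hx, rfl⟩ _ ⟨y, hy, rfl⟩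
    exact ⟨x + y, hadd x hx y hy, map_add e x y⟩
  · rintro _ ⟨x, hx, rfl⟩ _ ⟨y, hy, rfl⟩
    exact ⟨x * y, hmul x hx y hy, map_mul e x y⟩
  · exact (htot (e.symm x)).imp (fun h => ⟨_, h, by simp⟩) (fun h => ⟨_, h, by simp⟩)
  · rintro ⟨x, hx, h⟩
    have : x = -1 := e.injective (by simpa using h)
    exact hneg (this ▸ hx)

end IsOrderingCone

/-- Every preordering of a field is contained in an ordering. -/
theorem exists_isOrderingCone_of_preordering {E : Type*} [Field E] {T : Set E}
    (hadd : ∀ x ∈ T, ∀ y ∈ T, x + y ∈ T) (hmul : ∀ x ∈ T, ∀ y ∈ T, x * y ∈ T)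
    (hsq : ∀ x : E, x * x ∈ T) (hneg : (-1 : E) ∉ T) :
    ∃ Q : Set E, IsOrderingCone E Q ∧ T ⊆ Q := by
  obtain ⟨M, hTM, hM⟩ := zorn_subset_nonempty
    {S : Set E | (∀ x ∈ S, ∀ y ∈ S, x + y ∈ S) ∧ (∀ x ∈ S, ∀ y ∈ S, x * y ∈ S) ∧
      (∀ x : E, x * x ∈ S) ∧ (-1 : E) ∉ S} (fun c hc hchain hne => by
        have key : ∀ x ∈ ⋃₀ c, ∀ y ∈ ⋃₀ c, ∃ S ∈ c, x ∈ S ∧ y ∈ S := by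
          rintro x ⟨A, hA, hx⟩ y ⟨B, hB, hy⟩
          rcases hchain.total hA hB with h | h
          · exact ⟨B, hB, h hx, hy⟩
          · exact ⟨A, hA, hx, h hy⟩
        refine ⟨⋃₀ c, ⟨fun x hx y hy => ?_, fun x hx y hy => ?_, fun x => ?_, ?_⟩,
          fun S hS => Set.subset_sUnion_of_mem hS⟩
        · obtain ⟨S, hS, h₁, h₂⟩ := key x hx y hy
          exact ⟨S, hS, (hc hS).1 x h₁ y h₂⟩
        · obtain ⟨S, hS, h₁, h₂⟩ := key x hx y hy
          exact ⟨S, hS, (hc hS).2.1 x h₁ y h₂⟩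
        · obtain ⟨S, hS⟩ := hne
          exact ⟨S, hS, (hc hS).2.2.1 x⟩
        · rintro ⟨S, hS, h⟩
          exact (hc hS).2.2.2 h) T ⟨hadd, hmul, hsq, hneg⟩
  obtain ⟨⟨madd, mmul, msq, mneg⟩, hmax⟩ := hM
  refine ⟨M, ⟨madd, mmul, fun x => ?_, mneg⟩, hTM⟩
  by_contra! hx
  obtain ⟨hx, hx'⟩ := hx
  have m0 : (0 : E) ∈ M := by simpa using msq 0
  have m1 : (1 : E) ∈ M := by simpa using msq 1
  let S : Set E := {z | ∃ s ∈ M, ∃ t ∈ M, z = s - x * t}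
  have hMS : M ⊆ S := fun s hs => ⟨s, hs, 0, m0, by simp⟩
  have hS : S ⊆ M := by
    refine hmax ⟨?_, ?_, fun y => hMS (msq y), ?_⟩ hMS
    · rintro _ ⟨s, hs, t, ht, rfl⟩ _ ⟨s', hs', t', ht', rfl⟩
      exact ⟨s + s', madd _ hs _ hs', t + t', madd _ ht _ ht', by ring⟩
    · rintro _ ⟨s, hs, t, ht, rfl⟩ _ ⟨s', hs', t', ht', rfl⟩
      exact ⟨s * s' + x * x * (t * t'),
        madd _ (mmul _ hs _ hs') _ (mmul _ (msq x) _ (mmul _ ht _ ht')),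
        s * t' + t * s', madd _ (mmul _ hs _ ht') _ (mmul _ ht _ hs'), by ring⟩
    · rintro ⟨s, hs, t, ht, h⟩
      have ht0 : t ≠ 0 := by
        rintro rfl
        exact mneg (by simpa [h] using hs)
      refine hx ?_
      have := mmul _ (mmul _ (madd _ m1 _ hs) _ ht) _ (msq t⁻¹)
      have e : (1 + s) * t * (t⁻¹ * t⁻¹) = x := by
        field_simp
        linear_combination -h
      rwa [e] at this
  exact hx' (hS ⟨0, m0, 1, m1, by simp⟩)

/-- The sums `∑ qᵢ xᵢ²` with `qᵢ ∈ P`. -/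
def weightedSumsOfSquares {F : Type*} [Field F] (P : Set F) (A : Type*) [CommRing A]
    [Algebra F A] : AddSubmonoid A :=
  AddSubmonoid.closure {z | ∃ q ∈ P, ∃ x : A, z = algebraMap F A q * (x * x)}

/-- An ordering extends to an overfield as soon as `-1` is not a weighted sum of squares. -/
theorem IsOrderingCone.exists_extension {F E : Type*} [Field F] [Field E] [Algebra F E] {P : Set F}
    (hP : IsOrderingCone F P) (h : (-1 : E) ∉ weightedSumsOfSquares P E) :
    ∃ Q : Set E, IsOrderingCone E Q ∧ algebraMap F E '' P ⊆ Q := by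
  obtain ⟨Q, hQ, hTQ⟩ := exists_isOrderingCone_of_preordering
    (T := (weightedSumsOfSquares P E : Set E)) (fun x hx y hy => add_mem hx hy)
    (fun x hx y hy => by
      induction hx, hy using AddSubmonoid.closure_induction₂ with
      | mem x y hx hy =>
        obtain ⟨q, hq, x, rfl⟩ := hx
        obtain ⟨r, hr, y, rfl⟩ := hy
        exact AddSubmonoid.subset_closure
          ⟨q * r, hP.2.1 q hq r hr, x * y, by rw [map_mul]; ring⟩
      | zero_left x hx => simp
      | zero_right x hx => simp
      | add_left x y z hx hy hz h₁ h₂ => rw [add_mul]; exact add_mem h₁ h₂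
      | add_right x y z hx hy hz h₁ h₂ => rw [mul_add]; exact add_mem h₁ h₂)
    (fun x => AddSubmonoid.subset_closure ⟨1, hP.one_mem, x, by simp⟩) h
  refine ⟨Q, hQ, ?_⟩
  rintro _ ⟨q, hq, rfl⟩
  exact hTQ (AddSubmonoid.subset_closure ⟨q, hq, 1, by simp⟩)

/-- An ordering extends to a quadratic extension generated by the square root of a
nonnegative element. -/
theorem IsOrderingCone.exists_extension_of_sq {F E : Type*} [Field F] [Field E] [Algebra F E]
    {P : Set F} (hP : IsOrderingCone F P) {k : F} (hk : k ∈ P) {z : E}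
    (hz : z * z = algebraMap F E k) (hzF : z ∉ Set.range (algebraMap F E))
    (hE : ∀ x : E, ∃ u v : F, x = algebraMap F E u + algebraMap F E v * z) :
    ∃ Q : Set E, IsOrderingCone E Q ∧ algebraMap F E '' P ⊆ Q := by
  refine hP.exists_extension fun h => ?_
  have key : ∀ w ∈ weightedSumsOfSquares P E,
      ∃ c ∈ P, ∃ d : F, w = algebraMap F E c + algebraMap F E d * z := by
    intro w hw
    induction hw using AddSubmonoid.closure_induction with
    | mem w hw =>
      obtain ⟨q, hq, x, rfl⟩ := hw
      obtain ⟨u, v, rfl⟩ := hE x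
      refine ⟨q * (u * u + k * (v * v)), hP.2.1 _ hq _ (hP.1 _ (hP.mul_self_mem u) _
        (hP.2.1 _ hk _ (hP.mul_self_mem v))), q * (2 * (u * v)), ?_⟩
      simp only [map_mul, map_add, map_ofNat]
      linear_combination (algebraMap F E q * algebraMap F E v ^ 2) * hz
    | zero => exact ⟨0, hP.zero_mem, 0, by simp⟩
    | add x y _ _ hx hy =>
      obtain ⟨c, hc, d, rfl⟩ := hx
      obtain ⟨c', hc', d', rfl⟩ := hy
      exact ⟨c + c', hP.1 _ hc _ hc', d + d', by simp only [map_add]; ring⟩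
  obtain ⟨c, hc, d, hcd⟩ := key _ h
  by_cases hd : d = 0
  · refine hP.2.2.2 ?_
    have : c = -1 := (algebraMap F E).injective (by simpa [hd] using hcd.symm)
    exact this ▸ hc
  · refine hzF ⟨(-1 - c) / d, ?_⟩
    have hd' : algebraMap F E d ≠ 0 := by simpa using hd
    rw [map_div₀, div_eq_iff hd']
    simp only [map_sub, map_neg, map_one]
    linear_combination hcd

open Polynomial in
/-- Weighted sums of squares of polynomials over an ordered field have even degree and positive
leading coefficient. -/
theorem even_natDegree_of_mem_closure {F : Type*} [Field F] [LinearOrder F] [IsStrictOrderedRing F]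
    (n : ℕ) {p : F[X]}
    (hp : p ∈ AddSubmonoid.closure
      {z : F[X] | ∃ q : F, 0 ≤ q ∧ ∃ g : F[X], g.natDegree < n ∧ z = C q * (g * g)}) :
    p = 0 ∨ (Even p.natDegree ∧ 0 < p.leadingCoeff ∧ p.natDegree + 2 ≤ 2 * n) := by
  induction hp using AddSubmonoid.closure_induction with
  | mem z hz =>
    obtain ⟨q, hq, g, hg, rfl⟩ := hz
    rcases hq.eq_or_lt with rfl | hq
    · simp
    by_cases hg0 : g = 0
    · simp [hg0]
    have hd : (C q * (g * g)).natDegree = g.natDegree + g.natDegree := by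
      rw [natDegree_C_mul hq.ne', natDegree_mul hg0 hg0]
    refine .inr ⟨⟨_, hd⟩, ?_, by lia⟩
    have : g.leadingCoeff ≠ 0 := leadingCoeff_ne_zero.mpr hg0
    rw [leadingCoeff_mul, leadingCoeff_mul, leadingCoeff_C]
    exact mul_pos hq (mul_self_pos.mpr this)
  | zero => simp
  | add x y _ _ hx hy =>
    rcases hx with rfl | ⟨ex, lx, dx⟩
    · simpa using hy
    rcases hy with rfl | ⟨ey, ly, dy⟩
    · simpa using Or.inr ⟨ex, lx, dx⟩
    right
    rcases lt_trichotomy x.natDegree y.natDegree with h | h | h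
    · rw [natDegree_add_eq_right_of_natDegree_lt h,
        leadingCoeff_add_of_degree_lt (degree_lt_degree h)]
      exact ⟨ey, ly, dy⟩
    · have hs : x.leadingCoeff + y.leadingCoeff ≠ 0 := (add_pos lx ly).ne'
      have hd : x.degree = y.degree := by
        rw [degree_eq_natDegree (leadingCoeff_ne_zero.mp lx.ne'),
          degree_eq_natDegree (leadingCoeff_ne_zero.mp ly.ne'), h]
      have hxy : (x + y).natDegree = y.natDegree := by
        apply natDegree_eq_of_degree_eq
        rw [degree_add_eq_of_leadingCoeff_add_ne_zero hs, hd, max_self]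
      rw [hxy, leadingCoeff_add_of_degree_eq hd hs]
      exact ⟨ey, add_pos lx ly, dy⟩
    · rw [natDegree_add_eq_left_of_natDegree_lt h,
        leadingCoeff_add_of_degree_lt' (degree_lt_degree h)]
      exact ⟨ex, lx, dx⟩

open Polynomial in
/-- Over an ordered field, `1 + ∑ qᵢ gᵢ²` with `qᵢ ≥ 0` has no divisor of odd degree. -/
theorem not_dvd_one_add_of_odd_natDegree {F : Type*} [Field F] {P : Set F}
    (hP : IsOrderingCone F P) (f : F[X]) (hf : Odd f.natDegree) (w : F[X])
    (hw : w ∈ weightedSumsOfSquares P F[X]) : ¬ f ∣ 1 + w := by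
  obtain ⟨_, _, hle⟩ := hP.exists_linearOrder
  induction hn : f.natDegree using Nat.strong_induction_on generalizing f w with
  | _ n ih =>
  intro hdvd
  subst hn
  let W : AddSubmonoid F[X] := AddSubmonoid.closure
    {z : F[X] | ∃ q : F, 0 ≤ q ∧ ∃ g : F[X], g.natDegree < f.natDegree ∧ z = C q * (g * g)}
  have hWle : W ≤ weightedSumsOfSquares P F[X] := by
    refine AddSubmonoid.closure_mono ?_
    rintro _ ⟨q, hq, g, -, rfl⟩
    exact ⟨q, (hle q).mp hq, g, rfl⟩
  have hf0 : f.natDegree ≠ 0 := fun h => by simp [h] at hf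
  have hred : ∀ v ∈ weightedSumsOfSquares P F[X], ∃ v' ∈ W, f ∣ v - v' := by
    intro v hv
    induction hv using AddSubmonoid.closure_induction with
    | mem z hz =>
      obtain ⟨q, hq, g, rfl⟩ := hz
      refine ⟨C q * ((g % f) * (g % f)), AddSubmonoid.subset_closure
        ⟨q, (hle q).mpr hq, _, natDegree_mod_lt g hf0, rfl⟩, ?_⟩
      refine ⟨C q * (g / f) * (g + g % f), ?_⟩
      rw [algebraMap_eq]
      linear_combination -(C q * (g + g % f)) * EuclideanDomain.div_add_mod g f
    | zero => exact ⟨0, W.zero_mem, by simp⟩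
    | add x y _ _ hx hy =>
      obtain ⟨x', hx', hdx⟩ := hx
      obtain ⟨y', hy', hdy⟩ := hy
      exact ⟨x' + y', W.add_mem hx' hy', by rw [add_sub_add_comm]; exact dvd_add hdx hdy⟩
  obtain ⟨w', hw', hdw⟩ := hred w hw
  have h1 : (1 : F[X]) ∈ W :=
    AddSubmonoid.subset_closure ⟨1, zero_le_one, 1, by simpa using Nat.pos_of_ne_zero hf0, by simp⟩
  have hdvd' : f ∣ 1 + w' := by
    have := dvd_sub hdvd hdw
    rwa [show 1 + w - (w - w') = 1 + w' by ring] at this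
  have hne : 1 + w' ≠ 0 := fun h => by
    have hw1 : w' = -1 := by linear_combination h
    rcases even_natDegree_of_mem_closure _ hw' with h0 | ⟨-, h0, -⟩
    · simp [h0] at h
    · rw [hw1, leadingCoeff_neg, leadingCoeff_one] at h0
      linarith
  obtain ⟨h, hh⟩ := hdvd'
  rcases even_natDegree_of_mem_closure _ (add_mem h1 hw') with h0 | ⟨he, -, hd⟩
  · exact hne h0
  have hh0 : f ≠ 0 ∧ h ≠ 0 := by
    constructor <;> rintro h0 <;> simp [h0] at hh <;> exact hne hh
  rw [hh, natDegree_mul hh0.1 hh0.2] at he hd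
  have hodd : Odd h.natDegree := by
    rw [Nat.even_add'] at he
    exact he.mp hf
  exact ih h.natDegree (by lia) h hodd w' (hWle hw') rfl ⟨f, by rw [hh, mul_comm]⟩

open Polynomial in
/-- An ordering extends to every extension of odd degree. -/
theorem IsOrderingCone.exists_extension_of_odd_finrank {F E : Type*} [Field F] [Field E]
    [Algebra F E] [FiniteDimensional F E] [Algebra.IsSeparable F E] {P : Set F}
    (hP : IsOrderingCone F P) (hodd : Odd (Module.finrank F E)) :
    ∃ Q : Set E, IsOrderingCone E Q ∧ algebraMap F E '' P ⊆ Q := by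
  obtain ⟨θ, hθ⟩ := Field.exists_primitive_element F E
  have hint : IsIntegral F θ := Algebra.IsIntegral.isIntegral θ
  have hdeg : (minpoly F θ).natDegree = Module.finrank F E := by
    rw [← IntermediateField.adjoin.finrank hint, hθ, IntermediateField.finrank_top']
  have hsurj : ∀ x : E, ∃ g : F[X], aeval θ g = x := by
    intro x
    have hx : x ∈ F⟮θ⟯.toSubalgebra := by rw [hθ]; trivial
    rw [IntermediateField.adjoin_simple_toSubalgebra_of_isAlgebraic hint.isAlgebraic,
      Algebra.adjoin_singleton_eq_range_aeval] at hx
    exact hx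
  refine hP.exists_extension fun h => ?_
  have key : ∀ z ∈ weightedSumsOfSquares P E, ∃ w ∈ weightedSumsOfSquares P F[X],
      aeval θ w = z := by
    intro z hz
    induction hz using AddSubmonoid.closure_induction with
    | mem z hz =>
      obtain ⟨q, hq, x, rfl⟩ := hz
      obtain ⟨g, rfl⟩ := hsurj x
      exact ⟨C q * (g * g), AddSubmonoid.subset_closure ⟨q, hq, g, rfl⟩, by simp⟩
    | zero => exact ⟨0, AddSubmonoid.zero_mem _, by simp⟩
    | add x y _ _ hx hy =>
      obtain ⟨v, hv, rfl⟩ := hx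
      obtain ⟨w, hw, rfl⟩ := hy
      exact ⟨v + w, AddSubmonoid.add_mem _ hv hw, by simp⟩
  obtain ⟨w, hw, hw1⟩ := key _ h
  exact not_dvd_one_add_of_odd_natDegree hP (minpoly F θ) (hdeg ▸ hodd) w hw
    (minpoly.dvd F θ (by simp [hw1]))

section Maximal

variable {K L : Type*} [Field K] [Field L] [Algebra K L]

/-- If an ordering of `K` extends to no proper intermediate field, then nonnegative elements
have no new square roots. -/
theorem mem_range_of_mul_self_of_maximal {P : Set K} (hP : IsOrderingCone K P)
    (hmax : ∀ (E : IntermediateField K L) (Q : Set E), IsOrderingCone E Q →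
      algebraMap K E '' P ⊆ Q → E = ⊥)
    {z : L} {k : K} (hk : k ∈ P) (hz : z * z = algebraMap K L k) :
    z ∈ Set.range (algebraMap K L) := by
  by_contra hzK
  have hint : IsIntegral K z :=
    ⟨Polynomial.X ^ 2 - Polynomial.C k, Polynomial.monic_X_pow_sub_C _ two_ne_zero, by
      simp [← hz, sq]⟩
  let z' : K⟮z⟯ := ⟨z, mem_adjoin_simple_self K z⟩
  obtain ⟨Q, hQ, hPQ⟩ := hP.exists_extension_of_sq (E := K⟮z⟯) hk (z := z') (Subtype.ext hz)
    (by
      rintro ⟨c, hc⟩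
      exact hzK ⟨c, congrArg Subtype.val hc⟩)
    (by
      rintro ⟨x, hx⟩
      have hx' : x ∈ K⟮z⟯.toSubalgebra := hx
      rw [adjoin_simple_toSubalgebra_of_isAlgebraic hint.isAlgebraic] at hx'
      suffices ∃ u v : K, x = algebraMap K L u + algebraMap K L v * z by
        obtain ⟨u, v, h⟩ := this
        exact ⟨u, v, Subtype.ext h⟩
      clear hx
      induction hx' using Algebra.adjoin_induction with
      | mem x hx => exact ⟨0, 1, by simpa using hx⟩
      | algebraMap r => exact ⟨r, 0, by simp⟩
      | add x y _ _ hx hy =>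
        obtain ⟨u, v, rfl⟩ := hx
        obtain ⟨u', v', rfl⟩ := hy
        exact ⟨u + u', v + v', by simp only [map_add]; ring⟩
      | mul x y _ _ hx hy =>
        obtain ⟨u, v, rfl⟩ := hx
        obtain ⟨u', v', rfl⟩ := hy
        refine ⟨u * u' + v * v' * k, u * v' + u' * v, ?_⟩
        simp only [map_add, map_mul]
        linear_combination (algebraMap K L v * algebraMap K L v') * hz)
  have hbot := hmax _ Q hQ hPQ
  have : z ∈ (⊥ : IntermediateField K L) := hbot ▸ mem_adjoin_simple_self K z
  exact hzK (mem_bot.mp this)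

variable [IsGalois K L] [FiniteDimensional K L]

/-- If an ordering of `K` extends to no proper intermediate field of `L / K`, then the Galois
group is a `2`-group. -/
theorem exists_card_eq_two_pow_of_maximal {P : Set K} (hP : IsOrderingCone K P)
    (hmax : ∀ (E : IntermediateField K L) (Q : Set E), IsOrderingCone E Q →
      algebraMap K E '' P ⊆ Q → E = ⊥) :
    ∃ n, Nat.card (L ≃ₐ[K] L) = 2 ^ n := by
  obtain ⟨S⟩ : Nonempty (Sylow 2 (L ≃ₐ[K] L)) := inferInstance
  have hodd : Odd (Module.finrank K (fixedField (S : Subgroup (L ≃ₐ[K] L)))) := by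
    rw [IntermediateField.finrank_eq_fixingSubgroup_index, fixingSubgroup_fixedField]
    have := S.not_dvd_index
    rw [← Nat.not_even_iff_odd, even_iff_two_dvd]
    exact this
  obtain ⟨Q, hQ, hPQ⟩ := hP.exists_extension_of_odd_finrank hodd
  have hbot := hmax _ Q hQ hPQ
  have htop : (S : Subgroup (L ≃ₐ[K] L)) = ⊤ := by
    rw [← fixingSubgroup_fixedField (S : Subgroup (L ≃ₐ[K] L)), hbot, fixingSubgroup_bot]
  obtain ⟨n, hn⟩ := IsPGroup.iff_card.mp S.2
  exact ⟨n, by rw [← hn, htop, Subgroup.card_top]⟩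

/-- If an ordering of `K` extends to no proper intermediate field of `L / K`, then a subgroup of
index two in the Galois group has no subgroup of relative index two. -/
theorem not_exists_index_two_chain_of_maximal {P : Set K} (hP : IsOrderingCone K P)
    (hmax : ∀ (E : IntermediateField K L) (Q : Set E), IsOrderingCone E Q →
      algebraMap K E '' P ⊆ Q → E = ⊥)
    {H₁ H₂ : Subgroup (L ≃ₐ[K] L)} (h₁ : H₁.index = 2) (h₂ : H₂.relIndex H₁ = 2)
    (h₁₂ : H₂ ≤ H₁) : False := by
  have h2K : (2 : K) ≠ 0 := by
    obtain ⟨_, _, -⟩ := hP.exists_linearOrder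
    exact two_ne_zero
  have h2L : (2 : L) ≠ 0 := by
    rw [← map_ofNat (algebraMap K L) 2]
    exact (map_ne_zero _).mpr h2K
  have fixed : ∀ x : L, (∀ g : L ≃ₐ[K] L, g x = x) → ∃ k : K, algebraMap K L k = x := fun x hx =>
    (IsGalois.mem_range_algebraMap_iff_fixed x).mpr hx
  obtain ⟨σ, hσ⟩ : ∃ σ, σ ∉ H₁ := by
    by_contra! h
    rw [(Subgroup.eq_top_iff' H₁).mpr h] at h₁
    simp at h₁
  have hσH : ∀ g, g ∉ H₁ → σ⁻¹ * g ∈ H₁ := fun g hg => by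
    rw [Subgroup.mul_mem_iff_of_index_two h₁]
    simp [hσ, hg]
  obtain ⟨τ, hτ, hτ₂⟩ : ∃ τ ∈ H₁, τ ∉ H₂ := by
    by_contra! h
    rw [Subgroup.relIndex_eq_one.mpr h] at h₂
    simp at h₂
  have hrel : ∀ a ∈ H₁, ∀ b ∈ H₁, a * b ∈ H₂ ↔ (a ∈ H₂ ↔ b ∈ H₂) := fun a ha b hb => by
    have := Subgroup.mul_mem_iff_of_index_two (H := H₂.subgroupOf H₁) h₂
      (a := ⟨a, ha⟩) (b := ⟨b, hb⟩)
    simpa only [Subgroup.mem_subgroupOf, Subgroup.coe_mul] using this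
  have fixed₁ : ∀ x : L, (∀ h ∈ H₁, h x = x) → σ x = x → ∃ k : K, algebraMap K L k = x := by
    refine fun x hx hσx => fixed x fun g => ?_
    by_cases hg : g ∈ H₁
    · exact hx g hg
    · rw [show g = σ * (σ⁻¹ * g) by group, AlgEquiv.mul_apply, hx _ (hσH g hg), hσx]
  have fixed₂ : ∀ x : L, (∀ h ∈ H₂, h x = x) → τ x = x → ∀ h ∈ H₁, h x = x := by
    intro x hx hτx g hg
    by_cases hg₂ : g ∈ H₂
    · exact hx g hg₂
    · have : τ⁻¹ * g ∈ H₂ := by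
        rw [hrel _ (inv_mem hτ) _ hg]
        simp [hτ₂, hg₂]
      rw [show g = τ * (τ⁻¹ * g) by group, AlgEquiv.mul_apply, hx _ this, hτx]
  have antifixed : ∀ H : Subgroup (L ≃ₐ[K] L), ∀ ρ : L ≃ₐ[K] L, ρ ∉ H → ρ * ρ ∈ H →
      (∀ h ∈ H, ρ⁻¹ * h * ρ ∈ H) → ∃ δ : L, δ ≠ 0 ∧ ρ δ = -δ ∧ ∀ h ∈ H, h δ = δ := by
    intro H ρ hρ hρ2 hn
    obtain ⟨x, hx, hρx⟩ : ∃ x ∈ fixedField H, ρ x ≠ x := by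
      by_contra! h
      exact hρ (fixingSubgroup_fixedField H ▸ (mem_fixingSubgroup_iff _ _).mpr h)
    rw [mem_fixedField_iff] at hx
    refine ⟨x - ρ x, sub_ne_zero.mpr hρx.symm, ?_, fun h hh => ?_⟩
    · have := hx _ hρ2
      rw [AlgEquiv.mul_apply] at this
      rw [map_sub, this]
      ring
    · have := hx _ (hn h hh)
      have e : h (ρ x) = ρ x := by
        rw [← AlgEquiv.mul_apply, show h * ρ = ρ * (ρ⁻¹ * h * ρ) by group, AlgEquiv.mul_apply,
          this]
      rw [map_sub, hx h hh, e]
  obtain ⟨δ, hδ0, hσδ, hδ⟩ := antifixed H₁ σ hσ (Subgroup.mul_self_mem_of_index_two h₁ σ)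
    (fun h hh => by simp [Subgroup.mul_mem_iff_of_index_two h₁, hh])
  obtain ⟨β, hβ0, hτβ, hβ⟩ := antifixed H₂ τ hτ₂
    (by simp [hrel _ hτ _ hτ])
    (fun h hh => by
      rw [hrel _ (mul_mem (inv_mem hτ) (h₁₂ hh)) _ hτ, hrel _ (inv_mem hτ) _ (h₁₂ hh)]
      simp [hh])
  have hsq := fun (z : L) (k : K) (hk : k ∈ P) (hz : z * z = algebraMap K L k) =>
    mem_range_of_mul_self_of_maximal hP hmax hk hz
  -- elements moved by some automorphism have negative squares
  have hneg : ∀ (z : L) (k : K) (g : L ≃ₐ[K] L), z ≠ 0 → g z = -z → z * z = algebraMap K L k →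
      -k ∈ P := by
    intro z k g hz0 hgz hzk
    rcases hP.2.2.1 k with hk | hk
    · obtain ⟨c, rfl⟩ := hsq z k hk hzk
      rw [AlgEquiv.commutes] at hgz
      have : (2 : L) * algebraMap K L c = 0 := by linear_combination hgz
      exact absurd this (mul_ne_zero h2L hz0)
    · exact hk
  have hδ₁ : ∀ h ∈ H₁, h (δ * δ) = δ * δ := fun h hh => by rw [map_mul, hδ h hh]
  obtain ⟨a, ha⟩ := fixed₁ (δ * δ) hδ₁ (by rw [map_mul, hσδ]; ring)
  have haP : -a ∈ P := hneg δ a σ hδ0 hσδ ha.symm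
  have hb : ∀ h ∈ H₁, h (β * β) = β * β :=
    fixed₂ _ (fun h hh => by rw [map_mul, hβ h hh]) (by rw [map_mul, hτβ]; ring)
  have hτδ := hδ τ hτ
  by_cases hσb : σ (β * β) = β * β
  · obtain ⟨b, hb'⟩ := fixed₁ _ hb hσb
    have hbP : -b ∈ P := hneg β b τ hβ0 hτβ hb'.symm
    have habP : -(a * b) ∈ P := by
      refine hneg (β * δ) (a * b) τ (mul_ne_zero hβ0 hδ0) (by rw [map_mul, hτβ, hτδ]; ring) ?_
      rw [map_mul, ha, hb']
      ring
    have hab0 : a * b = 0 :=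
      hP.eq_zero_of_neg_mem (by simpa using hP.2.1 _ haP _ hbP) habP
    rcases mul_eq_zero.mp hab0 with h | h
    · rw [h, map_zero, eq_comm, mul_self_eq_zero] at ha
      exact hδ0 ha
    · rw [h, map_zero, eq_comm, mul_self_eq_zero] at hb'
      exact hβ0 hb'
  · have hσσ : ∀ x : L, (∀ h ∈ H₁, h x = x) → σ (σ x) = x := fun x hx => by
      rw [← AlgEquiv.mul_apply]
      exact hx _ (Subgroup.mul_self_mem_of_index_two h₁ σ)
    have hσfix : ∀ x : L, (∀ h ∈ H₁, h x = x) → ∀ h ∈ H₁, h (σ x) = σ x := fun x hx h hh => by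
      have hc : σ⁻¹ * h * σ ∈ H₁ := by simp [Subgroup.mul_mem_iff_of_index_two h₁, hh]
      rw [← AlgEquiv.mul_apply, show h * σ = σ * (σ⁻¹ * h * σ) by group, AlgEquiv.mul_apply,
        hx _ hc]
    obtain ⟨b, hbdef⟩ : ∃ b, b = β * β := ⟨_, rfl⟩
    rw [← hbdef] at hb hσb
    have hb2 := hσσ b hb
    have hσb' := hσfix b hb
    obtain ⟨u, hu⟩ := fixed₁ ((b + σ b) / 2)
      (fun h hh => by rw [map_div₀, map_add, hb h hh, hσb' h hh, map_ofNat])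
      (by rw [map_div₀, map_add, hb2, map_ofNat, add_comm])
    obtain ⟨v, hv⟩ := fixed₁ ((b - σ b) / (2 * δ))
      (fun h hh => by rw [map_div₀, map_sub, hb h hh, hσb' h hh, map_mul, map_ofNat, hδ h hh])
      (by
        rw [map_div₀, map_sub, hb2, map_mul, map_ofNat, hσδ, mul_neg, div_neg, ← neg_div, neg_sub])
    have hu' : b + σ b = 2 * algebraMap K L u := by rw [hu]; field_simp
    have hv' : b - σ b = 2 * δ * algebraMap K L v := by rw [hv]; field_simp
    obtain ⟨m, hm⟩ := hsq (β * σ β) (u * u + (-a) * (v * v))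
      (hP.1 _ (hP.mul_self_mem u) _ (hP.2.1 _ haP _ (hP.mul_self_mem v)))
      (by
        have e : β * σ β * (β * σ β) = b * σ b := by rw [hbdef, map_mul]; ring
        rw [e]
        simp only [map_add, map_mul, map_neg, ha]
        have e4 : (4 : L) ≠ 0 := by
          rw [show (4 : L) = 2 * 2 by norm_num]
          exact mul_ne_zero h2L h2L
        apply mul_left_cancel₀ e4
        linear_combination (b + σ b + 2 * algebraMap K L u) * hu' -
          (b - σ b + 2 * δ * algebraMap K L v) * hv')
    have hτσβ : τ (σ β) = -σ β := by
      have h3 : τ (β * σ β) = β * σ β := by rw [← hm, AlgEquiv.commutes]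
      rw [map_mul, hτβ] at h3
      apply mul_left_cancel₀ hβ0
      linear_combination -h3
    have hσb2 : σ b = σ β * σ β := by rw [hbdef, map_mul]
    have hs0 : β + σ β ≠ 0 := fun h => hσb (by
      rw [hσb2, hbdef]
      linear_combination (σ β - β) * h)
    have hd0 : β - σ β ≠ 0 := fun h => hσb (by
      rw [hσb2, hbdef]
      linear_combination (-σ β - β) * h)
    have hs : (β + σ β) * (β + σ β) = algebraMap K L (2 * u + 2 * m) := by
      simp only [map_add, map_mul, map_ofNat, hm]
      linear_combination hu' - hσb2 - hbdef
    have hd : (β - σ β) * (β - σ β) = algebraMap K L (2 * u - 2 * m) := by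
      simp only [map_sub, map_mul, map_ofNat, hm]
      linear_combination hu' - hσb2 - hbdef
    have hsP := hneg _ _ τ hs0 (by rw [map_add, hτβ, hτσβ]; ring) hs
    have hdP := hneg _ _ τ hd0 (by rw [map_sub, hτβ, hτσβ]; ring) hd
    have hprod : (2 * u + 2 * m) * (2 * u - 2 * m) = a * ((2 * v) * (2 * v)) := by
      apply (algebraMap K L).injective
      rw [map_mul, ← hs, ← hd]
      simp only [map_mul, map_ofNat, ha]
      linear_combination (b - σ b + 2 * δ * algebraMap K L v) * hv' -
        (b - σ b + (β + σ β) * (β - σ β)) * (hbdef - hσb2)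
    have h0 : (2 * u + 2 * m) * (2 * u - 2 * m) = 0 := by
      refine hP.eq_zero_of_neg_mem (neg_mul_neg (2 * u + 2 * m) _ ▸ hP.2.1 _ hsP _ hdP) ?_
      rw [hprod, ← neg_mul]
      exact hP.2.1 _ haP _ (hP.mul_self_mem _)
    rcases mul_eq_zero.mp h0 with h | h
    · rw [h, map_zero, mul_self_eq_zero] at hs
      exact hs0 hs
    · rw [h, map_zero, mul_self_eq_zero] at hd
      exact hd0 hd

/-- If an ordering of `K` extends to no proper intermediate field of `L / K` and `L` is not
formally real, then the Galois group has order two. -/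
theorem card_eq_two_of_maximal {P : Set K} (hP : IsOrderingCone K P)
    (hmax : ∀ (E : IntermediateField K L) (Q : Set E), IsOrderingCone E Q →
      algebraMap K E '' P ⊆ Q → E = ⊥)
    (hL : ¬ IsFormallyRealField L) : Nat.card (L ≃ₐ[K] L) = 2 := by
  obtain ⟨n, hn⟩ := exists_card_eq_two_pow_of_maximal hP hmax
  match n, hn with
  | 0, hn =>
    exfalso
    rw [pow_zero, IsGalois.card_aut_eq_finrank] at hn
    have hsurj : Function.Surjective (algebraMap K L) := by
      intro x
      have : x ∈ (⊥ : IntermediateField K L) := by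
        rw [IntermediateField.bot_eq_top_iff_finrank_eq_one.mpr hn]
        trivial
      exact mem_bot.mp this
    exact hL ⟨_, hP.image_ringEquiv
      (RingEquiv.ofBijective (algebraMap K L) ⟨(algebraMap K L).injective, hsurj⟩)⟩
  | 1, hn => simpa using hn
  | n + 2, hn =>
    exfalso
    have : Fact (Nat.Prime 2) := ⟨Nat.prime_two⟩
    obtain ⟨H₂, hH₂, -⟩ := Sylow.exists_subgroup_card_pow_prime_le 2 (n := 0) (m := n)
      (hn ▸ pow_dvd_pow 2 (by lia)) (⊥ : Subgroup (L ≃ₐ[K] L)) (by simp) (by lia)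
    obtain ⟨H₁, hH₁, h₁₂⟩ := Sylow.exists_subgroup_card_pow_prime_le 2 (n := n) (m := n + 1)
      (hn ▸ pow_dvd_pow 2 (by lia)) H₂ hH₂ (by lia)
    refine not_exists_index_two_chain_of_maximal hP hmax (H₁ := H₁) (H₂ := H₂) ?_ ?_ h₁₂
    · have := H₁.card_mul_index
      rw [hn, hH₁, pow_succ 2 (n + 1)] at this
      exact Nat.eq_of_mul_eq_mul_left (by positivity) this
    · have := Subgroup.card_mul_index (H₂.subgroupOf H₁)
      rw [Nat.card_congr (Subgroup.subgroupOfEquivOfLe h₁₂).toEquiv, hH₁, hH₂, pow_succ] at this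
      exact Nat.eq_of_mul_eq_mul_left (by positivity) this

end Maximal

section Counting

open Finset

variable {F E J : Type*} [Field F] [LinearOrder F] [IsStrictOrderedRing F] [Fintype E]
  [LinearOrder E] [Fintype J] {s : E → E} {u v : E → (J → F) →ₗ[F] F} {a : F}

/-- A positive definite form `∑ u_σ² + a v_σ²` with `a < 0` has rank at most the number of
distinct functionals `u_σ`. -/
theorem card_le_card_filter_le_of_pos (hs : Function.Involutive s) (hu : ∀ σ, u (s σ) = u σ)
    (ha : a < 0)
    (hpos : ∀ c, c ≠ 0 → 0 < ∑ σ, (u σ c * u σ c + a * (v σ c * v σ c))) :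
    Fintype.card J ≤ #{σ | σ ≤ s σ} := by
  let f : (J → F) →ₗ[F] ({σ // σ ≤ s σ} → F) := LinearMap.pi fun σ => u σ.1
  have hf : Function.Injective f := by
    rw [injective_iff_map_eq_zero]
    intro c hc
    by_contra hc0
    have hle : ∀ σ, σ ≤ s σ → u σ c = 0 := fun σ h => congrFun hc ⟨σ, h⟩
    have h0 : ∀ σ, u σ c = 0 := fun σ => by
      rcases le_total σ (s σ) with h | h
      · exact hle σ h
      · rw [← hu]
        exact hle (s σ) (by rwa [hs σ])
    refine (hpos c hc0).not_ge (Finset.sum_nonpos fun σ _ => ?_)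
    rw [h0 σ]
    nlinarith [mul_self_nonneg (v σ c)]
  simpa [Fintype.card_subtype] using LinearMap.finrank_le_finrank_of_injective hf

/-- A negative definite form `∑ u_σ² + a v_σ²` has rank at most the number of functionals `v_σ`
which are distinct up to sign and not forced to vanish. -/
theorem card_le_card_filter_lt_of_neg (hs : Function.Involutive s) (hv : ∀ σ, v (s σ) = -v σ)
    (hneg : ∀ c, c ≠ 0 → ∑ σ, (u σ c * u σ c + a * (v σ c * v σ c)) < 0) :
    Fintype.card J ≤ #{σ | σ < s σ} := by
  let f : (J → F) →ₗ[F] ({σ // σ < s σ} → F) := LinearMap.pi fun σ => v σ.1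
  have hf : Function.Injective f := by
    rw [injective_iff_map_eq_zero]
    intro c hc
    by_contra hc0
    have hlt : ∀ σ, σ < s σ → v σ c = 0 := fun σ h => congrFun hc ⟨σ, h⟩
    have h0 : ∀ σ, v σ c = 0 := fun σ => by
      have hσ : v (s σ) c = -v σ c := by rw [hv, LinearMap.neg_apply]
      rcases lt_trichotomy σ (s σ) with h | h | h
      · exact hlt σ h
      · rw [← h] at hσ
        linarith
      · have := hlt (s σ) (by rwa [hs σ])
        linarith
    refine (hneg c hc0).not_ge (Finset.sum_nonneg fun σ _ => ?_)
    rw [h0 σ]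
    nlinarith [mul_self_nonneg (u σ c)]
  simpa [Fintype.card_subtype] using LinearMap.finrank_le_finrank_of_injective hf

omit [Field F] [LinearOrder F] [IsStrictOrderedRing F] [Fintype J] in
theorem card_filter_lt_eq_card_filter_gt (hs : Function.Involutive s) :
    #{σ | σ < s σ} = #{σ | s σ < σ} :=
  Finset.card_bij (fun σ _ => s σ) (by simp [hs _]) (fun _ _ _ _ h => hs.injective h)
    (fun σ hσ => ⟨s σ, by simpa [hs _] using hσ, hs σ⟩)

end Counting

section Signature

variable {K L : Type*} [Field K] [Field L] [Algebra K L] [IsGalois K L] [FiniteDimensional K L]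

omit [IsGalois K L] [FiniteDimensional K L] in
/-- Real and imaginary parts with respect to an involution of a field which is not formally
real, whose fixed field is ordered. -/
theorem exists_re_im (hL : ¬ IsFormallyRealField L) {ε : L ≃ₐ[K] L} (hε : orderOf ε = 2)
    {Q : Set (fixedField (Subgroup.zpowers ε))} (hQ : IsOrderingCone _ Q) :
    ∃ (a : fixedField (Subgroup.zpowers ε))
      (re im : L →ₗ[fixedField (Subgroup.zpowers ε)] fixedField (Subgroup.zpowers ε)),
      a ∉ Q ∧ (∀ z, re (ε z) = re z) ∧ (∀ z, im (ε z) = -im z) ∧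
      (∀ z, re (z * z) = re z * re z + a * (im z * im z)) ∧
      ∀ m : fixedField (Subgroup.zpowers ε), re (m : L) = m := by
  have h2 : (2 : L) ≠ 0 := by
    obtain ⟨_, _, -⟩ := hQ.exists_linearOrder
    rw [← map_ofNat (algebraMap (fixedField (Subgroup.zpowers ε)) L) 2]
    exact (map_ne_zero _).mpr two_ne_zero
  have hεε : ∀ z, ε (ε z) = z := fun z => by
    have := pow_orderOf_eq_one ε
    rw [hε, sq] at this
    rw [← AlgEquiv.mul_apply, this, AlgEquiv.one_apply]
  have hmem : ∀ z, ε z = z → z ∈ fixedField (Subgroup.zpowers ε) := fun z hz => by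
    have : Subgroup.zpowers ε ≤ MulAction.stabilizer (L ≃ₐ[K] L) z := by
      rw [Subgroup.zpowers_le]
      exact hz
    exact (mem_fixedField_iff _ _).mpr fun f hf => this hf
  have hfix : ∀ m : fixedField (Subgroup.zpowers ε), ε (m : L) = m := fun m =>
    (mem_fixedField_iff _ _).mp m.2 ε (Subgroup.mem_zpowers ε)
  obtain ⟨δ, hδ0, hδ⟩ : ∃ δ : L, δ ≠ 0 ∧ ε δ = -δ := by
    obtain ⟨x, hx⟩ : ∃ x, ε x ≠ x := by
      by_contra! h
      have : ε = 1 := AlgEquiv.ext h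
      rw [this, orderOf_one] at hε
      simp at hε
    exact ⟨x - ε x, sub_ne_zero.mpr hx.symm, by rw [map_sub, hεε]; ring⟩
  let re : L →ₗ[fixedField (Subgroup.zpowers ε)] fixedField (Subgroup.zpowers ε) :=
    { toFun := fun z => ⟨(z + ε z) / 2, hmem _ (by
        rw [map_div₀, map_add, hεε, map_ofNat, add_comm])⟩
      map_add' := fun x y => Subtype.ext (by
        simp only [map_add, IntermediateField.coe_add]; ring)
      map_smul' := fun m x => Subtype.ext (by
        simp only [IntermediateField.smul_def, smul_eq_mul, map_mul, hfix, RingHom.id_apply,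
          IntermediateField.coe_mul]
        ring) }
  let im : L →ₗ[fixedField (Subgroup.zpowers ε)] fixedField (Subgroup.zpowers ε) :=
    { toFun := fun z => ⟨(z - ε z) / (2 * δ), hmem _ (by
        rw [map_div₀, map_sub, hεε, map_mul, map_ofNat, hδ, mul_neg, div_neg, ← neg_div,
          neg_sub])⟩
      map_add' := fun x y => Subtype.ext (by
        simp only [map_add, IntermediateField.coe_add]; ring)
      map_smul' := fun m x => Subtype.ext (by
        simp only [IntermediateField.smul_def, smul_eq_mul, map_mul, hfix, RingHom.id_apply,
          IntermediateField.coe_mul]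
        ring) }
  have hre : ∀ z, (re z : L) = (z + ε z) / 2 := fun z => rfl
  have him : ∀ z, (im z : L) = (z - ε z) / (2 * δ) := fun z => rfl
  let a : fixedField (Subgroup.zpowers ε) := ⟨δ * δ, hmem _ (by rw [map_mul, hδ]; ring)⟩
  have ha : (a : L) = δ * δ := rfl
  refine ⟨a, re, im, fun haQ => hL ?_, fun z => ?_, fun z => ?_, fun z => ?_, fun m => ?_⟩
  · obtain ⟨R, hR, -⟩ := hQ.exists_extension_of_sq (E := L) haQ (z := δ) rfl
      (by
        rintro ⟨c, rfl⟩
        have h : algebraMap (fixedField (Subgroup.zpowers ε)) L c = -algebraMap _ L c :=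
          (hfix c).symm.trans hδ
        have : 2 * algebraMap (fixedField (Subgroup.zpowers ε)) L c = 0 := by
          linear_combination h
        exact mul_ne_zero h2 hδ0 this)
      (fun x => ⟨re x, im x, by
        change x = (re x : L) + (im x : L) * δ
        rw [hre, him]
        field_simp
        ring⟩)
    exact ⟨R, hR⟩
  · exact Subtype.ext (by rw [hre, hre, hεε, add_comm])
  · exact Subtype.ext (by rw [IntermediateField.coe_neg, him, him, hεε]; ring)
  · apply Subtype.ext
    rw [IntermediateField.coe_add, IntermediateField.coe_mul, IntermediateField.coe_mul,
      IntermediateField.coe_mul, hre, hre, him, ha, map_mul]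
    field_simp
    ring
  · apply Subtype.ext
    rw [hre, hfix]
    field_simp
    ring

/-- The trace is the sum of the embeddings into a normal extension. -/
theorem algebraMap_trace_eq_sum_algHom (N : IntermediateField K L) (x : N) :
    algebraMap K L (Algebra.trace K N x) = ∑ σ : N →ₐ[K] L, σ x := by
  apply (algebraMap L (AlgebraicClosure L)).injective
  have hsplit : ∀ x : N, ((minpoly K x).map (algebraMap K L)).Splits := fun x => by
    rw [← minpoly.algebraMap_eq (algebraMap N L).injective]
    exact IsGalois.splits K (algebraMap N L x)
  rw [← IsScalarTower.algebraMap_apply, map_sum, trace_eq_sum_embeddings (AlgebraicClosure L)]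
  symm
  exact Fintype.sum_equiv
    (Algebra.IsAlgebraic.algHomEquivAlgHomOfSplits (AlgebraicClosure L) L hsplit) _ _ fun σ => rfl

open Finset in
/-- Bounds for the number of positive and negative entries of a diagonalized trace form in terms
of the action of an involution on embeddings. -/
theorem card_diagonal_le (hL : ¬ IsFormallyRealField L) {P : Set K} (hP : IsOrderingCone K P)
    {ε : L ≃ₐ[K] L} (hε : orderOf ε = 2)
    {Q : Set (fixedField (Subgroup.zpowers ε))} (hQ : IsOrderingCone _ Q)
    (hPQ : algebraMap K (fixedField (Subgroup.zpowers ε)) '' P ⊆ Q)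
    (N : IntermediateField K L) [LinearOrder (N →ₐ[K] L)] {ι : Type*} [Fintype ι]
    (b : ι → N) {d : ι → K} (hd0 : ∀ i, d i ≠ 0)
    (hd : ∀ i, Algebra.trace K N (b i * b i) = d i)
    (hb : ∀ i j, i ≠ j → Algebra.trace K N (b i * b j) = 0) :
    Nat.card {i // d i ∈ P} ≤ #{σ : N →ₐ[K] L | σ ≤ ε.toAlgHom.comp σ} ∧
    Nat.card {i // d i ∉ P} ≤ #{σ : N →ₐ[K] L | σ < ε.toAlgHom.comp σ} := by
  classical
  obtain ⟨a, re, im, ha, hre, him, hsq, hrem⟩ := exists_re_im hL hε hQ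
  obtain ⟨_, _, hle⟩ := hQ.exists_linearOrder
  have ha' : a < 0 := by
    rw [← not_le, hle]
    exact ha
  have hs : Function.Involutive fun σ : N →ₐ[K] L => ε.toAlgHom.comp σ := fun σ => by
    have h1 := pow_orderOf_eq_one ε
    rw [hε, sq] at h1
    ext x
    exact DFunLike.congr_fun h1 (σ x)
  have form : ∀ (J : Type _) [Fintype J] (e : J ↪ ι)
      (c : J → fixedField (Subgroup.zpowers ε)),
      ∑ σ : N →ₐ[K] L,
        (re (∑ j, c j • σ (b (e j))) * re (∑ j, c j • σ (b (e j))) +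
          a * (im (∑ j, c j • σ (b (e j))) * im (∑ j, c j • σ (b (e j))))) =
      ∑ j, algebraMap K _ (d (e j)) * (c j * c j) := by
    intro J _ e c
    simp_rw [← hsq]
    rw [← map_sum, ← hrem (∑ j, algebraMap K _ (d (e j)) * (c j * c j))]
    congr 1
    simp_rw [Finset.sum_mul_sum]
    rw [Finset.sum_comm, AddSubmonoidClass.coe_finsetSum]
    refine Finset.sum_congr rfl fun i _ => ?_
    rw [Finset.sum_comm, Finset.sum_eq_single i]
    · have : ∑ σ : N →ₐ[K] L, σ (b (e i) * b (e i)) = algebraMap K L (d (e i)) := by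
        rw [← algebraMap_trace_eq_sum_algHom, hd]
      simp only [IntermediateField.smul_def, smul_eq_mul, IntermediateField.coe_mul]
      rw [show ((algebraMap K (fixedField (Subgroup.zpowers ε)) (d (e i)) : _) : L) =
        algebraMap K L (d (e i)) from rfl, ← this, Finset.sum_mul]
      refine Finset.sum_congr rfl fun σ _ => ?_
      rw [map_mul]
      ring
    · intro j _ hji
      have : ∑ σ : N →ₐ[K] L, σ (b (e i) * b (e j)) = 0 := by
        rw [← algebraMap_trace_eq_sum_algHom, hb _ _ (fun h => hji (e.injective h).symm),
          map_zero]
      calc _ = ∑ σ : N →ₐ[K] L, ((c i : L) * c j) * σ (b (e i) * b (e j)) := by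
            refine Finset.sum_congr rfl fun σ _ => ?_
            simp only [IntermediateField.smul_def, smul_eq_mul, map_mul]
            ring
        _ = 0 := by rw [← Finset.mul_sum, this, mul_zero]
    · simp
  have hex : ∀ (J : Type _) [Fintype J] (c : J → fixedField (Subgroup.zpowers ε)), c ≠ 0 →
      ∃ j, 0 < c j * c j := fun J _ c hc => by
    obtain ⟨j, hj⟩ := Function.ne_iff.mp hc
    exact ⟨j, mul_self_pos.mpr hj⟩
  have hne : ∀ i, algebraMap K (fixedField (Subgroup.zpowers ε)) (d i) ≠ 0 := fun i =>
    (map_ne_zero _).mpr (hd0 i)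
  constructor
  · rw [Nat.card_eq_fintype_card]
    refine card_le_card_filter_le_of_pos
      (u := fun σ => re.comp (Fintype.linearCombination _ fun i : {i // d i ∈ P} => σ (b i)))
      (v := fun σ => im.comp (Fintype.linearCombination _ fun i : {i // d i ∈ P} => σ (b i)))
      (a := a) hs ?_ ha' ?_
    · intro σ
      ext1 i
      ext1
      simp [Fintype.linearCombination_apply, hre]
    · intro c hc
      simp only [LinearMap.comp_apply, Fintype.linearCombination_apply]
      have hform := form _ (Function.Embedding.subtype fun i => d i ∈ P) c
      simp only [Function.Embedding.subtype_apply] at hform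
      rw [hform]
      have hpos : ∀ i : {i // d i ∈ P}, 0 < algebraMap K (fixedField (Subgroup.zpowers ε)) (d i) :=
        fun i => lt_of_le_of_ne ((hle _).mpr (hPQ ⟨_, i.2, rfl⟩)) (hne i).symm
      obtain ⟨j, hj⟩ := hex _ c hc
      exact Finset.sum_pos' (fun i _ => mul_nonneg (hpos i).le (mul_self_nonneg _))
        ⟨j, Finset.mem_univ _, mul_pos (hpos j) hj⟩
  · rw [Nat.card_eq_fintype_card]
    refine card_le_card_filter_lt_of_neg
      (u := fun σ => re.comp (Fintype.linearCombination _ fun i : {i // d i ∉ P} => σ (b i)))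
      (v := fun σ => im.comp (Fintype.linearCombination _ fun i : {i // d i ∉ P} => σ (b i)))
      (a := a) hs ?_ ?_
    · intro σ
      ext1 i
      ext1
      simp [Fintype.linearCombination_apply, him]
    · intro c hc
      simp only [LinearMap.comp_apply, Fintype.linearCombination_apply]
      have hform := form _ (Function.Embedding.subtype fun i => d i ∉ P) c
      simp only [Function.Embedding.subtype_apply] at hform
      rw [hform]
      have hneg : ∀ i : {i // d i ∉ P},
          0 < -algebraMap K (fixedField (Subgroup.zpowers ε)) (d i) := fun i => by
        refine lt_of_le_of_ne ((hle _).mpr ?_) (neg_ne_zero.mpr (hne i)).symm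
        rw [← map_neg]
        exact hPQ ⟨_, (hP.2.2.1 _).resolve_left i.2, rfl⟩
      obtain ⟨j, hj⟩ := hex _ c hc
      rw [← neg_pos, ← Finset.sum_neg_distrib]
      simp_rw [← neg_mul]
      exact Finset.sum_pos' (fun i _ => mul_nonneg (hneg i).le (mul_self_nonneg _))
        ⟨j, Finset.mem_univ _, mul_pos (hneg j) hj⟩

end Signature

section Conjugacy

variable {K L : Type*} [Field K] [Field L] [Algebra K L]

/-- An ordering of the base which extends to an intermediate field also extends to its
conjugates. -/
theorem exists_extension_map {P : Set K} {M : IntermediateField K L} {Q : Set M}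
    (hQ : IsOrderingCone M Q) (hPQ : algebraMap K M '' P ⊆ Q) (σ : L ≃ₐ[K] L) :
    ∃ R : Set (M.map σ.toAlgHom), IsOrderingCone _ R ∧
      algebraMap K (M.map σ.toAlgHom) '' P ⊆ R := by
  refine ⟨_, hQ.image_ringEquiv (intermediateFieldMap σ M).toRingEquiv, ?_⟩
  rintro _ ⟨x, hx, rfl⟩
  exact ⟨algebraMap K M x, hPQ ⟨x, hx, rfl⟩, (intermediateFieldMap σ M).commutes x⟩

theorem map_fixedField_zpowers (ε σ : L ≃ₐ[K] L) :
    (fixedField (Subgroup.zpowers ε)).map σ.toAlgHom =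
      fixedField (Subgroup.zpowers (σ * ε * σ⁻¹)) := by
  have hmem : ∀ (τ : L ≃ₐ[K] L) (z : L), z ∈ fixedField (Subgroup.zpowers τ) ↔ τ z = z := by
    refine fun τ z => ⟨fun h => (mem_fixedField_iff _ _).mp h τ (Subgroup.mem_zpowers τ), ?_⟩
    intro h
    have : Subgroup.zpowers τ ≤ MulAction.stabilizer (L ≃ₐ[K] L) z := by
      rw [Subgroup.zpowers_le]
      exact h
    exact (mem_fixedField_iff _ _).mpr fun f hf => this hf
  have hσ : ∀ z, σ (σ⁻¹ z) = z := fun z => σ.apply_symm_apply z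
  have hσ' : ∀ z, σ⁻¹ (σ z) = z := fun z => σ.symm_apply_apply z
  ext z
  rw [IntermediateField.mem_map, hmem]
  simp only [AlgEquiv.mul_apply]
  constructor
  · rintro ⟨y, hy, rfl⟩
    rw [hmem] at hy
    change σ (ε (σ⁻¹ (σ y))) = σ y
    rw [hσ', hy]
  · intro h
    refine ⟨σ⁻¹ z, (hmem _ _).mpr ?_, hσ z⟩
    apply σ.injective
    rw [h, hσ]

variable [IsGalois K L] [FiniteDimensional K L]

/-- Some involution with ordered fixed field exists over every ordering of the base. -/
theorem exists_involution_extension (hL : ¬ IsFormallyRealField L) {P : Set K}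
    (hP : IsOrderingCone K P) :
    ∃ ε : L ≃ₐ[K] L, orderOf ε = 2 ∧
      ∃ Q : Set (fixedField (Subgroup.zpowers ε)), IsOrderingCone _ Q ∧
        algebraMap K (fixedField (Subgroup.zpowers ε)) '' P ⊆ Q := by
  have hbot : ∃ Q : Set (⊥ : IntermediateField K L), IsOrderingCone _ Q ∧
      algebraMap K (⊥ : IntermediateField K L) '' P ⊆ Q := by
    refine ⟨_, hP.image_ringEquiv (IntermediateField.botEquiv K L).symm.toRingEquiv, ?_⟩
    rintro _ ⟨x, hx, rfl⟩
    exact ⟨x, hx, (IntermediateField.botEquiv K L).symm.commutes x⟩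
  have : Finite (IntermediateField K L) :=
    Field.finite_intermediateField_of_exists_primitive_element K L
      (Field.exists_primitive_element K L)
  obtain ⟨M, ⟨Q, hQ, hPQ⟩, hmax⟩ := WellFounded.has_min
    (wellFounded_gt : WellFounded fun M N : IntermediateField K L => M > N)
    {M : IntermediateField K L | ∃ Q : Set M, IsOrderingCone M Q ∧ algebraMap K M '' P ⊆ Q}
    ⟨⊥, hbot⟩
  have hcard : Nat.card (L ≃ₐ[M] L) = 2 := by
    refine card_eq_two_of_maximal hQ (fun E R hR hQR => ?_) hL
    have hE : ¬ M < E.restrictScalars K := fun h => hmax (E.restrictScalars K)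
      ⟨R, hR, by
        rintro _ ⟨x, hx, rfl⟩
        exact hQR ⟨algebraMap K M x, hPQ ⟨x, hx, rfl⟩, rfl⟩⟩ h
    have hle : M ≤ E.restrictScalars K := fun x hx => E.algebraMap_mem ⟨x, hx⟩
    rw [eq_bot_iff]
    intro x hx
    have hx' : x ∈ M := by
      rw [eq_of_le_of_not_lt hle hE]
      exact hx
    exact IntermediateField.mem_bot.mpr ⟨⟨x, hx'⟩, rfl⟩
  rw [← Nat.card_congr (fixingSubgroupEquiv M).toEquiv] at hcard
  obtain ⟨ε, hε⟩ := exists_prime_orderOf_dvd_card' (G := M.fixingSubgroup) 2 hcard.symm.dvd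
  have hε2 : orderOf (ε : L ≃ₐ[K] L) = 2 := by rw [Subgroup.orderOf_coe, hε]
  have hz : Subgroup.zpowers (ε : L ≃ₐ[K] L) = M.fixingSubgroup := by
    refine Subgroup.eq_of_le_of_card_ge ?_ ?_
    · rw [Subgroup.zpowers_le]
      exact ε.2
    · rw [Nat.card_zpowers, hε2, hcard]
  refine ⟨ε, hε2, ?_⟩
  rw [hz, IsGalois.fixedField_fixingSubgroup]
  exact ⟨Q, hQ, hPQ⟩

open Finset in
/-- Over an ordering of the base, an involution with ordered fixed field fixes some embedding of
the fixed field of any other one. -/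
theorem exists_comp_eq (hL : ¬ IsFormallyRealField L) {P : Set K}
    (hP : IsOrderingCone K P) {ε ε' : L ≃ₐ[K] L} (hε : orderOf ε = 2) (hε' : orderOf ε' = 2)
    {Q : Set (fixedField (Subgroup.zpowers ε))} (hQ : IsOrderingCone _ Q)
    (hPQ : algebraMap K (fixedField (Subgroup.zpowers ε)) '' P ⊆ Q)
    {Q' : Set (fixedField (Subgroup.zpowers ε'))} (hQ' : IsOrderingCone _ Q')
    (hPQ' : algebraMap K (fixedField (Subgroup.zpowers ε')) '' P ⊆ Q') :
    ∃ σ : fixedField (Subgroup.zpowers ε') →ₐ[K] L, ε.toAlgHom.comp σ = σ := by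
  classical
  by_contra! hne
  let N := fixedField (Subgroup.zpowers ε')
  have h2 : (2 : K) ≠ 0 := by
    obtain ⟨_, _, -⟩ := hP.exists_linearOrder
    exact two_ne_zero
  let _ : Invertible (2 : K) := invertibleOfNonzero h2
  have hinv : ∀ τ : L ≃ₐ[K] L, orderOf τ = 2 →
      Function.Involutive fun σ : N →ₐ[K] L => τ.toAlgHom.comp σ := fun τ hτ σ => by
    have h1 := pow_orderOf_eq_one τ
    rw [hτ, sq] at h1
    ext x
    exact DFunLike.congr_fun h1 (σ x)
  obtain ⟨b, hb⟩ := LinearMap.BilinForm.exists_orthogonal_basis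
    (B := Algebra.traceForm K N) ⟨fun x y => (Algebra.traceForm_isSymm K).eq x y⟩
  have hd0 := hb.not_isOrtho_basis_self_of_separatingLeft (traceForm_nondegenerate K N).1
  let _ : LinearOrder (N →ₐ[K] L) :=
    LinearOrder.lift' (Fintype.equivFin (N →ₐ[K] L)) (Equiv.injective _)
  have key := fun (τ : L ≃ₐ[K] L) (hτ : orderOf τ = 2)
      (R : Set (fixedField (Subgroup.zpowers τ))) (hR : IsOrderingCone _ R)
      (hPR : algebraMap K (fixedField (Subgroup.zpowers τ)) '' P ⊆ R) =>
    card_diagonal_le hL hP hτ hR hPR N b (d := fun i => Algebra.trace K N (b i * b i))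
      hd0 (fun i => rfl) (fun i j hij => hb hij)
  have hp := (key ε hε Q hQ hPQ).1
  have hq := (key ε' hε' Q' hQ' hPQ').2
  have hn : Fintype.card (N →ₐ[K] L) = Module.finrank K N :=
    AlgHom.card_of_splits K N L fun x => by
      rw [← minpoly.algebraMap_eq (algebraMap N L).injective]
      exact IsGalois.splits K (algebraMap N L x)
  have hpq := Fintype.card_subtype_compl fun i => Algebra.trace K N (b i * b i) ∈ P
  have hple := Fintype.card_subtype_le fun i => Algebra.trace K N (b i * b i) ∈ P
  rw [Fintype.card_fin] at hpq hple
  rw [Nat.card_eq_fintype_card] at hp hq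
  have hcount : ∀ s : (N →ₐ[K] L) → (N →ₐ[K] L), #{σ | σ < s σ} + #{σ | s σ < σ} +
      #{σ | s σ = σ} = Fintype.card (N →ₐ[K] L) := fun s => by
    rw [← Finset.card_union_of_disjoint, ← Finset.card_union_of_disjoint, ← Finset.card_univ]
    · congr 1
      ext σ
      simpa [eq_comm, or_assoc, or_comm, or_left_comm] using lt_trichotomy σ (s σ)
    · rw [Finset.disjoint_left]
      intro σ h1 h2
      simp only [Finset.mem_union, Finset.mem_filter, Finset.mem_univ, true_and] at h1 h2
      rw [h2] at h1
      simp at h1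
    · rw [Finset.disjoint_left]
      intro σ h1 h2
      simp only [Finset.mem_filter, Finset.mem_univ, true_and] at h1 h2
      exact lt_asymm h1 h2
  have hc := hcount fun σ => ε.toAlgHom.comp σ
  have hc' := hcount fun σ => ε'.toAlgHom.comp σ
  have hsym := card_filter_lt_eq_card_filter_gt (hinv ε hε)
  have hsym' := card_filter_lt_eq_card_filter_gt (hinv ε' hε')
  have hle : #{σ : N →ₐ[K] L | σ ≤ ε.toAlgHom.comp σ} =
      #{σ : N →ₐ[K] L | σ < ε.toAlgHom.comp σ} := by
    congr 1
    ext σ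
    simp [le_iff_lt_or_eq, (hne σ).symm]
  have hpos : 0 < #{σ : N →ₐ[K] L | ε'.toAlgHom.comp σ = σ} :=
    Finset.card_pos.mpr ⟨N.val, by
      simp only [Finset.mem_filter, Finset.mem_univ, true_and]
      ext x
      exact (mem_fixedField_iff _ _).mp x.2 ε' (Subgroup.mem_zpowers ε')⟩
  have h0 : #{σ : N →ₐ[K] L | ε.toAlgHom.comp σ = σ} = 0 := by
    rw [Finset.card_eq_zero, Finset.filter_eq_empty_iff]
    exact fun σ _ => hne σ
  omega

theorem isConj_of_comp_eq {ε ε' : L ≃ₐ[K] L} (hε : orderOf ε = 2) (hε' : orderOf ε' = 2)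
    {σ : fixedField (Subgroup.zpowers ε') →ₐ[K] L} (hσ : ε.toAlgHom.comp σ = σ) :
    IsConj ε ε' := by
  let g : L ≃ₐ[K] L := AlgEquiv.ofBijective (σ.liftNormal L)
    (Algebra.IsAlgebraic.algHom_bijective _)
  have hg : ∀ x : fixedField (Subgroup.zpowers ε'), g x = σ x := fun x =>
    σ.liftNormal_commutes L x
  have hmem : g⁻¹ * ε * g ∈ Subgroup.zpowers ε' := by
    rw [← fixingSubgroup_fixedField (Subgroup.zpowers ε')]
    intro x
    change g.symm (ε (g x)) = x
    rw [AlgEquiv.symm_apply_eq, hg]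
    exact DFunLike.congr_fun hσ x
  have hone : g⁻¹ * ε * g ≠ 1 := fun h => by
    have : ε = 1 := conj_eq_one_iff.mp (by rwa [inv_inv] : g⁻¹ * ε * g⁻¹⁻¹ = 1)
    rw [this, orderOf_one] at hε
    simp at hε
  have heq : g⁻¹ * ε * g = ε' := by
    obtain ⟨k, hk⟩ := Subgroup.mem_zpowers_iff.mp hmem
    rw [← zpow_mod_orderOf, hε'] at hk
    rcases Int.emod_two_eq_zero_or_one k with h | h
    · exact absurd (by simpa [h] using hk.symm) hone
    · simpa [h] using hk.symm
  exact isConj_iff.mpr ⟨g⁻¹, by rw [inv_inv, heq]⟩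

end Conjugacy

/-- Let `L/K` be a finite Galois extension with `L` not formally real
and `P` an ordering of `K`.  Then the set `I_P(L/K)` of involutions `ε ∈ Gal(L/K)` such
that `P` extends to an ordering of the fixed field `L(ε)` is a (nonempty) full conjugacy
class of `Gal(L/K)`. -/
theorem real_involutions_form_conjugacy_class
    (K L : Type*) [Field K] [Field L] [Algebra K L] [IsGalois K L] [FiniteDimensional K L]
    (hL : ¬ IsFormallyRealField L)
    (P : Set K) (hP : IsOrderingCone K P) :
    letI IP : Set (L ≃ₐ[K] L) := {ε | orderOf ε = 2 ∧
      ∃ Q : Set ↥(fixedField (Subgroup.zpowers ε)),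
        IsOrderingCone ↥(fixedField (Subgroup.zpowers ε)) Q ∧
        (algebraMap K ↥(fixedField (Subgroup.zpowers ε))) '' P ⊆ Q}
    IP.Nonempty ∧
    (∀ ε ∈ IP, ∀ σ : L ≃ₐ[K] L, σ * ε * σ⁻¹ ∈ IP) ∧
    (∀ ε ∈ IP, ∀ ε' ∈ IP, IsConj ε ε') := by
  refine ⟨?_, ?_, ?_⟩
  · exact exists_involution_extension hL hP
  · rintro ε ⟨hε, Q, hQ, hPQ⟩ σ
    refine ⟨((MulAut.conj σ).orderOf_eq ε).trans hε, ?_⟩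
    rw [← map_fixedField_zpowers]
    exact exists_extension_map hQ hPQ σ
  · rintro ε ⟨hε, Q, hQ, hPQ⟩ ε' ⟨hε', Q', hQ', hPQ'⟩
    obtain ⟨σ, hσ⟩ := exists_comp_eq hL hP hε hε' hQ hPQ hQ' hPQ'
    exact isConj_of_comp_eq hε hε' hσ
end
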